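/- Let (X,d) be a compact metric space, φ: X×ℝ→X a continuous flow without fixed points, and μ an ergodic φ-invariant Borel probability measure on X. Then the Bowen entropy of the set of generic points of μ equals the measure-theoretic entropy of the time-one map: h_top^B(φ, G_μ(φ)) = h_μ(φ₁). -/

import Mathlib

open MeasureTheory Filter Set Topology
open scoped ENNReal NNReal

namespace FlowEntropy

variable {X : Type*}

/-- A continuous flow on `X`. -/
structure IsFlow [TopologicalSpace X] (φ : ℝ → X → X) : Prop where
  cont : Continuous fun p : ℝ × X => φ p.1 p.2
  map_zero : ∀ x, φ 0 x = x
  map_add : ∀ s t : ℝ, ∀ x, φ (s + t) x = φ s (φ t x)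

/-- The flow has no fixed points. -/
def FixedPointFree (φ : ℝ → X → X) : Prop :=
  ∀ x : X, ∃ t : ℝ, φ t x ≠ x

/-- The measure `μ` is invariant under every time-`t` map of the flow. -/
def FlowInvariant [MeasurableSpace X] (φ : ℝ → X → X) (μ : Measure X) : Prop :=
  ∀ t : ℝ, MeasurePreserving (φ t) μ μ

/-- The measure `μ` is invariant and ergodic for the flow: every Borel set invariant
under all time-`t` maps has measure `0` or `1`. -/
def FlowErgodic [MeasurableSpace X] (φ : ℝ → X → X) (μ : Measure X) : Prop :=
  FlowInvariant φ μ ∧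
    ∀ B : Set X, MeasurableSet B → (∀ t : ℝ, φ t ⁻¹' B = B) → μ B = 0 ∨ μ B = 1

/-- `α` is a reparametrization on the closed interval `I` (containing the origin):
a continuous map that is a homeomorphism onto its image (equivalently, continuous and
injective on the compact interval), fixing the origin. -/
def IsReparOn (α : ℝ → ℝ) (I : Set ℝ) : Prop :=
  ContinuousOn α I ∧ Set.InjOn α I ∧ α 0 = 0

/-- The reparametrization ball `B(x, t, ε, φ)`. -/
def reparBall [PseudoMetricSpace X] (φ : ℝ → X → X) (x : X) (t ε : ℝ) : Set X :=
  {y : X | ∃ α : ℝ → ℝ, IsReparOn α (Set.Icc 0 t) ∧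
      ∀ s ∈ Set.Icc (0 : ℝ) t, dist (φ (α s) x) (φ s y) < ε}

/-- `M^s_{N,ε}(φ, Z)`: infimum of `Σ_i exp (-s t_i)` over countable families of
reparametrization balls `B(x_i, t_i, ε, φ)` with `t_i ≥ N` covering `Z`. -/
noncomputable def coverM [PseudoMetricSpace X] (φ : ℝ → X → X) (Z : Set X) (s : ℝ) (N : ℕ)
    (ε : ℝ) : ℝ≥0∞ :=
  ⨅ (F : Set (X × ℝ)) (_ : F.Countable) (_ : ∀ p ∈ F, (N : ℝ) ≤ p.2)
    (_ : Z ⊆ ⋃ p ∈ F, reparBall φ p.1 p.2 ε),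
    ∑' p : F, ENNReal.ofReal (Real.exp (-s * (p : X × ℝ).2))

/-- `M^s_ε(φ, Z) = lim_{N → ∞} M^s_{N,ε}(φ, Z)` (an increasing limit). -/
noncomputable def coverMeps [PseudoMetricSpace X] (φ : ℝ → X → X) (Z : Set X) (s ε : ℝ) :
    ℝ≥0∞ :=
  ⨆ N : ℕ, coverM φ Z s N ε

/-- `M^s(φ, Z) = lim_{ε → 0} M^s_ε(φ, Z)` (an increasing limit as `ε` decreases). -/
noncomputable def coverMlim [PseudoMetricSpace X] (φ : ℝ → X → X) (Z : Set X) (s : ℝ) :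
    ℝ≥0∞ :=
  ⨆ (ε : ℝ) (_ : 0 < ε), coverMeps φ Z s ε

/-- The Bowen entropy `h_top^B(φ, Z)`: the critical value where `M^s(φ,Z)` jumps
from `∞` to `0` (as an extended nonnegative real; `⊤` if no finite critical value). -/
noncomputable def bowenEntropy [PseudoMetricSpace X] (φ : ℝ → X → X) (Z : Set X) : ℝ≥0∞ :=
  ⨅ (s : ℝ) (_ : 0 ≤ s) (_ : coverMlim φ Z s = 0), ENNReal.ofReal s

/-- Static entropy of a finite measurable partition, encoded as a map into a finite type. -/
noncomputable def partEnt [MeasurableSpace X] (μ : Measure X) {ι : Type*} [Fintype ι]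
    (P : X → ι) : ℝ :=
  ∑ i : ι, Real.negMulLog ((μ (P ⁻¹' {i})).toReal)

/-- The measure-theoretic (Kolmogorov–Sinai) entropy of a map `T` with respect to `μ`:
the supremum over finite measurable partitions of the asymptotic entropy per unit time of
the dynamical refinements. -/
noncomputable def kolSinai [MeasurableSpace X] (μ : Measure X) (T : X → X) : ℝ≥0∞ :=
  ⨆ (k : ℕ) (P : X → Fin k) (_ : Measurable P),
    Filter.limsup (fun n : ℕ =>
      ENNReal.ofReal (partEnt μ (fun x => fun j : Fin n => P (T^[(j : ℕ)] x)) / n))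
      Filter.atTop

/-- `-log a` as a member of `ℝ≥0∞`, for `a ∈ [0,1]` (with `-log 0 = ∞`). -/
noncomputable def negLogNN (a : ℝ≥0∞) : ℝ≥0∞ :=
  if a = 0 then ⊤ else ENNReal.ofReal (-Real.log a.toReal)

/-- `-(1/t) log μ(B(x,t,ε,φ))`, as a member of `ℝ≥0∞`. -/
noncomputable def localRate [PseudoMetricSpace X] [MeasurableSpace X] (μ : Measure X)
    (φ : ℝ → X → X) (x : X) (ε t : ℝ) : ℝ≥0∞ :=
  negLogNN (μ (reparBall φ x t ε)) / ENNReal.ofReal t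

/-- The lower local entropy `underline h_μ(φ, x) = lim_{ε→0} liminf_{t→∞}
  -(1/t) log μ(B(x,t,ε,φ))` (the limit in `ε` is an increasing limit, hence a supremum). -/
noncomputable def lowerLocalEnt [PseudoMetricSpace X] [MeasurableSpace X] (μ : Measure X)
    (φ : ℝ → X → X) (x : X) : ℝ≥0∞ :=
  ⨆ (ε : ℝ) (_ : 0 < ε), Filter.liminf (fun t : ℝ => localRate μ φ x ε t) Filter.atTop

/-- The upper local entropy `overline h_μ(φ, x) = lim_{ε→0} limsup_{t→∞}
  -(1/t) log μ(B(x,t,ε,φ))`. -/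
noncomputable def upperLocalEnt [PseudoMetricSpace X] [MeasurableSpace X] (μ : Measure X)
    (φ : ℝ → X → X) (x : X) : ℝ≥0∞ :=
  ⨆ (ε : ℝ) (_ : 0 < ε), Filter.limsup (fun t : ℝ => localRate μ φ x ε t) Filter.atTop

/-- The set `G_μ(φ)` of generic points of `μ` for the flow `φ`. -/
def genericPts [TopologicalSpace X] [MeasurableSpace X] (φ : ℝ → X → X) (μ : Measure X) :
    Set X :=
  {x : X | ∀ f : C(X, ℝ),
    Filter.Tendsto (fun t : ℝ => (1 / t) * ∫ τ in (0 : ℝ)..t, f (φ τ x))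
      Filter.atTop (nhds (∫ y, f y ∂μ))}

/-- The Gibbs inequality: the entropy of a finite partition is at most the mean of any code
length function. -/
lemma partEnt_le_integral [MeasurableSpace X] {μ : Measure X} [IsProbabilityMeasure μ]
    {κ : Type*} [Fintype κ] {R : X → κ} (hR : ∀ i, MeasurableSet (R ⁻¹' {i}))
    {q : κ → ℝ} (hq0 : ∀ i, 0 ≤ q i) (hq : ∑ i, q i ≤ 1) {G : X → ℝ} (hG : Integrable G μ)
    (h : ∀ x, Real.exp (-G x) ≤ q (R x)) : partEnt μ R ≤ ∫ x, G x ∂μ := by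
  have hcover : (⋃ i, R ⁻¹' {i}) = univ := by ext x; simp
  have hdisj : Pairwise (Function.onFun Disjoint fun i => R ⁻¹' {i}) := fun i j hij =>
    Disjoint.preimage _ (by simpa using hij)
  have hsplit : ∀ f : X → ℝ, Integrable f μ → ∫ x, f x ∂μ = ∑ i, ∫ x in R ⁻¹' {i}, f x ∂μ := by
    intro f hf
    rw [← integral_iUnion_fintype hR hdisj (fun i => hf.integrableOn), hcover, setIntegral_univ]
  have hone : ∑ i, (μ (R ⁻¹' {i})).toReal = 1 := by
    have := hsplit (fun _ => 1) (integrable_const _)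
    simpa [Measure.real] using this.symm
  have key : ∀ i, Real.negMulLog ((μ (R ⁻¹' {i})).toReal) ≤
      ∫ x in R ⁻¹' {i}, G x ∂μ + (q i - (μ (R ⁻¹' {i})).toReal) := by
    intro i
    rcases eq_or_ne (μ (R ⁻¹' {i})) 0 with h0 | h0
    · rw [Measure.restrict_eq_zero.2 h0]
      simp [h0, hq0 i]
    · obtain ⟨x, hx⟩ : (R ⁻¹' {i}).Nonempty := nonempty_of_measure_ne_zero h0
      have hqi : 0 < q i := by
        have := h x
        rw [show R x = i from hx] at this
        exact (Real.exp_pos _).trans_le this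
      have hp : 0 < (μ (R ⁻¹' {i})).toReal := ENNReal.toReal_pos h0 (measure_ne_top _ _)
      have hinteg : (μ (R ⁻¹' {i})).toReal * (-Real.log (q i)) ≤ ∫ x in R ⁻¹' {i}, G x ∂μ := by
        have : ∫ x in R ⁻¹' {i}, (-Real.log (q i)) ∂μ ≤ ∫ x in R ⁻¹' {i}, G x ∂μ := by
          refine setIntegral_mono_on (by simp) hG.integrableOn (hR i) fun y hy => ?_
          have := h y
          rw [show R y = i from hy] at this
          have := Real.log_le_log (Real.exp_pos _) this
          rw [Real.log_exp] at this
          linarith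
        simpa [Measure.real] using this
      set p := (μ (R ⁻¹' {i})).toReal
      have hlog := Real.log_le_sub_one_of_pos (div_pos hqi hp)
      rw [Real.log_div hqi.ne' hp.ne'] at hlog
      have := mul_le_mul_of_nonneg_left hlog hp.le
      have e : p * (q i / p - 1) = q i - p := by field_simp
      rw [Real.negMulLog]
      nlinarith
  calc partEnt μ R ≤ ∑ i, (∫ x in R ⁻¹' {i}, G x ∂μ + (q i - (μ (R ⁻¹' {i})).toReal)) :=
        Finset.sum_le_sum fun i _ => key i
    _ = ∫ x, G x ∂μ + (∑ i, q i - 1) := by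
        rw [Finset.sum_add_distrib, Finset.sum_sub_distrib, hone, ← hsplit G hG]
    _ ≤ _ := by linarith

/-- Probability of a string of length `n` for the source that keeps emitting the code words
`word c` with probability `w c`, where a code word is a list of letter distributions; `l` is what
remains of the code word being emitted. -/
noncomputable def codeProb {ι κ : Type*} [Fintype κ] (w : κ → ℝ) (word : κ → List (ι → ℝ)) :
    (n : ℕ) → List (ι → ℝ) → (Fin n → ι) → ℝ
  | 0, _, _ => 1
  | n + 1, p :: l, ω => p (ω 0) * codeProb w word n l (Fin.tail ω)
  | n + 1, [], ω => ∑ c, w c * match word c with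
    | [] => 0
    | p :: l => p (ω 0) * codeProb w word n l (Fin.tail ω)

/-- A sub-probability vector. -/
def IsSubProb {ι : Type*} [Fintype ι] (p : ι → ℝ) : Prop := (∀ i, 0 ≤ p i) ∧ ∑ i, p i ≤ 1

lemma IsSubProb.le_one {ι : Type*} [Fintype ι] {p : ι → ℝ} (hp : IsSubProb p) (i : ι) :
    p i ≤ 1 :=
  (Finset.single_le_sum (fun j _ => hp.1 j) (Finset.mem_univ i)).trans hp.2

section Code

variable {ι κ : Type*} [Fintype ι] [Fintype κ] {w : κ → ℝ} {word : κ → List (ι → ℝ)}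

lemma codeProb_nonneg (hw : IsSubProb w) (hword : ∀ c, ∀ p ∈ word c, IsSubProb p) :
    ∀ (n : ℕ) (l : List (ι → ℝ)) (_ : ∀ p ∈ l, IsSubProb p) (ω : Fin n → ι),
      0 ≤ codeProb w word n l ω := by
  intro n
  induction n with
  | zero => intro l _ ω; simp [codeProb]
  | succ n ih =>
    intro l hl ω
    have hcons : ∀ (p : ι → ℝ) (l : List (ι → ℝ)), (∀ p' ∈ p :: l, IsSubProb p') →
        0 ≤ p (ω 0) * codeProb w word n l (Fin.tail ω) := fun p l h =>
      mul_nonneg ((h p (by simp)).1 _) (ih l (fun p' hp' => h p' (by simp [hp'])) _)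
    cases l with
    | cons p l => exact hcons p l hl
    | nil =>
      rw [codeProb]
      refine Finset.sum_nonneg fun c _ => mul_nonneg (hw.1 c) ?_
      have := hword c
      split
      · exact le_rfl
      · next p l h => exact hcons p l (h ▸ this)

lemma sum_codeProb_le_one (hw : IsSubProb w) (hword : ∀ c, ∀ p ∈ word c, IsSubProb p) :
    ∀ (n : ℕ) (l : List (ι → ℝ)) (_ : ∀ p ∈ l, IsSubProb p),
      ∑ ω : Fin n → ι, codeProb w word n l ω ≤ 1 := by
  intro n
  induction n with
  | zero => intro l _; simp [codeProb]
  | succ n ih =>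
    intro l hl
    have hcons : ∀ (p : ι → ℝ) (l : List (ι → ℝ)), (∀ p' ∈ p :: l, IsSubProb p') →
        ∑ ω : Fin (n + 1) → ι, p (ω 0) * codeProb w word n l (Fin.tail ω) ≤ 1 := by
      intro p l h
      rw [← (Fin.consEquiv fun _ => ι).sum_comp, Fintype.sum_prod_type]
      simp only [Fin.consEquiv, Equiv.coe_fn_mk, Fin.cons_zero, Fin.tail_cons,
        ← Finset.mul_sum, ← Finset.sum_mul]
      have h1 := h p (by simp)
      have h2 := ih l (fun p' hp' => h p' (by simp [hp']))
      have h3 : 0 ≤ ∑ ω : Fin n → ι, codeProb w word n l ω := Finset.sum_nonneg fun ω _ =>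
        codeProb_nonneg hw hword n l (fun p' hp' => h p' (by simp [hp'])) ω
      exact mul_le_one₀ h1.2 h3 h2
    cases l with
    | cons p l => exact hcons p l hl
    | nil =>
      simp only [codeProb]
      rw [Finset.sum_comm]
      simp only [← Finset.mul_sum]
      refine (Finset.sum_le_sum fun c _ => mul_le_of_le_one_right (hw.1 c) ?_).trans hw.2
      have := hword c
      split
      · simp
      · next p l h => exact hcons p l (h ▸ this)

/-- Probability that the letters `Q y, Q (T y), …` are drawn from the list of letter
distributions `l`. -/
def listProb (T : X → X) (Q : X → ι) : List (ι → ℝ) → X → ℝ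
  | [], _ => 1
  | p :: l, y => p (Q y) * listProb T Q l (T y)

lemma listProb_mem_Icc (T : X → X) (Q : X → ι) (l : List (ι → ℝ)) (hl : ∀ p ∈ l, IsSubProb p)
    (y : X) : listProb T Q l y ∈ Icc (0 : ℝ) 1 := by
  induction l generalizing y with
  | nil => simp [listProb]
  | cons p l ih =>
    have h1 := hl p (by simp)
    have h2 := ih (fun p' hp' => hl p' (by simp [hp'])) (T y)
    exact ⟨mul_nonneg (h1.1 _) h2.1, mul_le_one₀ (h1.le_one _) h2.1 h2.2⟩

/-- The itinerary of length `n` of a point. -/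
def itin {ι : Type*} (T : X → X) (Q : X → ι) (n : ℕ) (y : X) : Fin n → ι := fun j => Q (T^[j] y)

lemma listProb_mul_le_codeProb
    (T : X → X) (Q : X → ι) (l : List (ι → ℝ)) (hl : ∀ p ∈ l, IsSubProb p) (n : ℕ) (y : X) :
    listProb T Q l y * codeProb w word (n - l.length) []
      (itin T Q (n - l.length) (T^[l.length] y)) ≤ codeProb w word n l (itin T Q n y) := by
  induction l generalizing n y with
  | nil => simp [listProb]
  | cons p l ih =>
    cases n with
    | zero =>
      have e : 0 - (p :: l).length = 0 := by simp
      rw [e]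
      simpa [codeProb] using (listProb_mem_Icc T Q _ hl y).2
    | succ n =>
      have e : n + 1 - (p :: l).length = n - l.length := by simp
      rw [e, codeProb, listProb, mul_assoc]
      refine mul_le_mul_of_nonneg_left ?_ ((hl p (by simp)).1 _)
      exact ih (fun p' hp' => hl p' (by simp [hp'])) n (T y)

lemma weight_mul_codeProb_le (hw : IsSubProb w) (hword : ∀ c, ∀ p ∈ word c, IsSubProb p)
    (c : κ) (hc : word c ≠ []) (n : ℕ) (ω : Fin (n + 1) → ι) :
    w c * codeProb w word (n + 1) (word c) ω ≤ codeProb w word (n + 1) [] ω := by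
  have hnn : ∀ c' : κ, 0 ≤ w c' * (match word c' with
    | [] => 0
    | p :: l => p (ω 0) * codeProb w word n l (Fin.tail ω)) := by
    intro c'
    refine mul_nonneg (hw.1 _) ?_
    have := hword c'
    split
    · exact le_rfl
    · next p l h =>
      rw [h] at this
      exact mul_nonneg ((this p (by simp)).1 _)
        (codeProb_nonneg hw hword _ _ (fun p' hp' => this p' (by simp [hp'])) _)
  conv_rhs => rw [codeProb]
  refine le_trans ?_ (Finset.single_le_sum (fun c' _ => hnn c') (Finset.mem_univ c))
  cases h : word c with
  | nil => exact absurd h hc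
  | cons p l => simp [codeProb]

/-- If every point starts with a code word whose cost is controlled by the Birkhoff sum of `F`,
then the cost of coding a long itinerary is controlled by the Birkhoff sum of `F`. -/
lemma exp_le_codeProb (hw : IsSubProb w) (hword : ∀ c, ∀ p ∈ word c, IsSubProb p)
    (hne : ∀ c, word c ≠ []) {L : ℕ} (hL : ∀ c, (word c).length ≤ L)
    {T : X → X} {Q : X → ι} {F : X → ℝ} (hF : ∀ x, 0 ≤ F x)
    (h : ∀ y, ∃ c, Real.exp (-birkhoffSum T F (word c).length y) ≤
      w c * listProb T Q (word c) y) (n : ℕ) (y : X) :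
    Real.exp (-birkhoffSum T F (n + L) y) ≤ codeProb w word n [] (itin T Q n y) := by
  have hmono : ∀ y, Monotone fun n => birkhoffSum T F n y := fun y =>
    monotone_nat_of_le_succ fun n => by
      rw [birkhoffSum_succ]
      linarith [hF (T^[n] y)]
  induction n using Nat.strong_induction_on generalizing y with
  | _ n ih =>
    cases n with
    | zero =>
      simp only [codeProb]
      refine Real.exp_le_one_iff.2 (neg_nonpos.2 ?_)
      exact (birkhoffSum_zero T F y).symm.le.trans (hmono y (Nat.zero_le _))
    | succ n =>
      obtain ⟨c, hc⟩ := h y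
      set m := (word c).length with hm
      have hm0 : 0 < m := List.length_pos_iff.2 (hne c)
      refine le_trans ?_ (weight_mul_codeProb_le hw hword c (hne c) n _)
      refine le_trans ?_ (mul_le_mul_of_nonneg_left (listProb_mul_le_codeProb T Q
        (word c) (hword c) (n + 1) y) (hw.1 c))
      rw [← hm, ← mul_assoc]
      have hlt : n + 1 - m < n + 1 := by omega
      rcases le_or_gt m (n + 1) with hle | hgt
      · have e : n + 1 + L = m + (n + 1 - m + L) := by omega
        rw [e, birkhoffSum_add, neg_add, Real.exp_add]
        exact mul_le_mul hc (ih _ hlt _) (Real.exp_pos _).le ((Real.exp_pos _).le.trans hc)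
      · have e : n + 1 - m = 0 := by omega
        rw [e]
        simp only [codeProb, mul_one]
        refine le_trans (Real.exp_le_exp.2 (neg_le_neg ?_)) hc
        exact hmono y ((hL c).trans (by omega))

lemma integral_birkhoffSum [MeasurableSpace X] {μ : Measure X} {T : X → X}
    (hT : MeasurePreserving T μ μ) {F : X → ℝ} (hF : Integrable F μ) (n : ℕ) :
    Integrable (birkhoffSum T F n) μ ∧ ∫ x, birkhoffSum T F n x ∂μ = n * ∫ x, F x ∂μ := by
  have hi : ∀ j, Integrable (fun x => F (T^[j] x)) μ := fun j =>
    (hT.iterate j).integrable_comp_of_integrable hF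
  have he : ∀ j, ∫ x, F (T^[j] x) ∂μ = ∫ x, F x ∂μ := fun j => by
    have := (hT.iterate j)
    rw [← integral_map (f := F) this.measurable.aemeasurable
      (by rw [this.map_eq]; exact hF.aestronglyMeasurable), this.map_eq]
  refine ⟨?_, ?_⟩
  · exact integrable_finsetSum _ fun j _ => hi j
  · simp only [birkhoffSum]
    rw [integral_finsetSum _ fun j _ => hi j]
    simp [he]

/-- The entropy of any function of the itinerary is bounded by the mean coding cost. -/
lemma partEnt_le_of_code [MeasurableSpace X] {μ : Measure X} [IsProbabilityMeasure μ]
    (hw : IsSubProb w) (hword : ∀ c, ∀ p ∈ word c, IsSubProb p)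
    (hne : ∀ c, word c ≠ []) {L : ℕ} (hL : ∀ c, (word c).length ≤ L)
    {T : X → X} (hT : MeasurePreserving T μ μ) {Q : X → ι} {F : X → ℝ} (hF : ∀ x, 0 ≤ F x)
    (hFi : Integrable F μ)
    (h : ∀ y, ∃ c, Real.exp (-birkhoffSum T F (word c).length y) ≤
      w c * listProb T Q (word c) y) (n : ℕ) {κ' : Type*} [Fintype κ'] {R : X → κ'}
    (hR : ∀ i, MeasurableSet (R ⁻¹' {i})) (π : (Fin n → ι) → κ')
    (hπ : ∀ y, R y = π (itin T Q n y)) :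
    partEnt μ R ≤ (n + L : ℕ) * ∫ x, F x ∂μ := by
  classical
  have hinteg := integral_birkhoffSum hT hFi (n + L)
  rw [← hinteg.2]
  have hnn := codeProb_nonneg hw hword n [] (by simp)
  refine partEnt_le_integral hR
    (q := fun v => ∑ ω with π ω = v, codeProb w word n [] ω)
    (fun v => Finset.sum_nonneg fun ω _ => hnn ω) ?_ hinteg.1 fun x => ?_
  · rw [Finset.sum_fiberwise Finset.univ π (codeProb w word n [])]
    exact sum_codeProb_le_one hw hword n [] (by simp)
  · refine (exp_le_codeProb hw hword hne hL hF h n x).trans ?_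
    exact Finset.single_le_sum (f := fun ω => codeProb w word n [] ω) (fun ω _ => hnn ω)
      (by simp [hπ])

end Code

/-- The maximal ergodic inequality, in the form needed for the pointwise ergodic theorem. -/
lemma le_integral_of_birkhoffSum_ge [MeasurableSpace X] {μ : Measure X} [IsProbabilityMeasure μ]
    {T : X → X} (hT : MeasurePreserving T μ μ) {f : X → ℝ} (hfm : Measurable f)
    (hfi : Integrable f μ) (hf : ∀ x, 0 ≤ f x) {c : ℝ} (hc : 0 ≤ c)
    (h : ∀ᵐ y ∂μ, ∃ m : ℕ, 1 ≤ m ∧ m * c ≤ birkhoffSum T f m y) : c ≤ ∫ x, f x ∂μ := by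
  have hSm : ∀ m, Measurable (birkhoffSum T f m) := fun m =>
    Finset.measurable_sum _ fun j _ => hfm.comp (hT.measurable.iterate j)
  set A : ℕ → Set X := fun L => {y | ∃ m, 1 ≤ m ∧ m ≤ L ∧ m * c ≤ birkhoffSum T f m y} with hA
  have hAm : ∀ L, MeasurableSet (A L) := fun L => by
    have : A L = ⋃ m ∈ {m : ℕ | 1 ≤ m ∧ m ≤ L}, {y | m * c ≤ birkhoffSum T f m y} := by
      ext y; simp [hA, and_assoc]
    rw [this]
    exact MeasurableSet.biUnion (to_countable _) fun m _ =>
      measurableSet_le measurable_const (hSm m)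
  have hAmono : Monotone A := fun L L' hL y ⟨m, h1, h2, h3⟩ => ⟨m, h1, h2.trans hL, h3⟩
  have hAfull : μ (⋃ L, A L) = 1 := by
    rw [prob_compl_eq_zero_iff (MeasurableSet.iUnion hAm) |>.symm]
    refine measure_mono_null ?_ (ae_iff.1 h)
    intro y hy hy'
    obtain ⟨m, h1, h2⟩ := hy'
    exact hy (mem_iUnion.2 ⟨m, m, h1, le_rfl, h2⟩)
  have hlim : Tendsto (fun L => μ.real (A L)) atTop (𝓝 1) := by
    have := tendsto_measure_iUnion_atTop (μ := μ) hAmono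
    rw [hAfull] at this
    exact (ENNReal.tendsto_toReal ENNReal.one_ne_top).comp this
  have hmono : ∀ y, Monotone fun n => birkhoffSum T f n y := fun y =>
    monotone_nat_of_le_succ fun n => by
      rw [birkhoffSum_succ]
      linarith [hf (T^[n] y)]
  have key : ∀ L, 1 ≤ L → c * μ.real (A L) ≤ ∫ x, f x ∂μ := by
    intro L hL
    set ψ : X → ℝ := (A L).indicator fun _ => c with hψ
    have hψ0 : ∀ y, 0 ≤ ψ y := fun y => indicator_nonneg (fun _ _ => hc) y
    have hψc : ∀ y, ψ y ≤ c := fun y => indicator_le_self' (fun _ _ => hc) y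
    have hψmono : ∀ y, Monotone fun n => birkhoffSum T ψ n y := fun y =>
      monotone_nat_of_le_succ fun n => by
        rw [birkhoffSum_succ]
        linarith [hψ0 (T^[n] y)]
    have hparse : ∀ y, ∃ m, 1 ≤ m ∧ m ≤ L ∧ birkhoffSum T ψ m y ≤ birkhoffSum T f m y := by
      intro y
      by_cases hy : y ∈ A L
      · obtain ⟨m, h1, h2, h3⟩ := hy
        refine ⟨m, h1, h2, le_trans ?_ h3⟩
        calc birkhoffSum T ψ m y ≤ ∑ _j ∈ Finset.range m, c :=
              Finset.sum_le_sum fun j _ => hψc _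
          _ = m * c := by simp
      · refine ⟨1, le_rfl, hL, ?_⟩
        simp [birkhoffSum_one, hψ, hy, hf y]
    have hcomp : ∀ n y, birkhoffSum T ψ n y ≤ birkhoffSum T f (n + L) y := by
      intro n
      induction n using Nat.strong_induction_on with
      | _ n ih =>
        intro y
        rcases Nat.eq_zero_or_pos n with rfl | hn
        · rw [birkhoffSum_zero]
          exact (birkhoffSum_zero T f y).symm.le.trans (hmono y (Nat.zero_le _))
        obtain ⟨m, h1, h2, h3⟩ := hparse y
        rcases le_or_gt m n with hle | hgt
        · have e1 : n + L = m + (n - m + L) := by omega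
          have e2 : birkhoffSum T ψ n y = birkhoffSum T ψ m y +
              birkhoffSum T ψ (n - m) (T^[m] y) := by
            rw [← birkhoffSum_add, Nat.add_sub_cancel' hle]
          rw [e1, e2, birkhoffSum_add]
          exact add_le_add h3 (ih _ (by omega) _)
        · exact ((hψmono y hgt.le).trans h3).trans (hmono y (by omega))
    have hψi : Integrable ψ μ := (integrable_const c).indicator (hAm L)
    have hψint : ∫ x, ψ x ∂μ = c * μ.real (A L) := by
      rw [integral_indicator (hAm L)]
      simp [mul_comm]
    have hn : ∀ n : ℕ, n * (c * μ.real (A L)) ≤ (n + L : ℕ) * ∫ x, f x ∂μ := by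
      intro n
      have h1 := integral_birkhoffSum hT hψi n
      have h2 := integral_birkhoffSum hT hfi (n + L)
      rw [← hψint, ← h1.2, ← h2.2]
      exact integral_mono h1.1 h2.1 (hcomp n)
    by_contra! hlt
    obtain ⟨n, hn'⟩ := exists_nat_gt (L * (∫ x, f x ∂μ) / (c * μ.real (A L) - ∫ x, f x ∂μ))
    have hpos : 0 < c * μ.real (A L) - ∫ x, f x ∂μ := by linarith
    rw [div_lt_iff₀ hpos] at hn'
    have := hn n
    push_cast at this
    nlinarith
  have := hlim.const_mul c
  rw [mul_one] at this
  refine le_of_tendsto this ?_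
  filter_upwards [eventually_ge_atTop 1] with L hL using key L hL

section Flow

variable {φ : ℝ → X → X}

section Topological

variable [TopologicalSpace X]

lemma IsFlow.continuous_orbit (hφ : IsFlow φ) (x : X) : Continuous fun τ => φ τ x :=
  hφ.cont.comp (continuous_id.prodMk continuous_const)

lemma IsFlow.continuous_time (hφ : IsFlow φ) (t : ℝ) : Continuous (φ t) :=
  hφ.cont.comp (continuous_const.prodMk continuous_id)

lemma IsFlow.iterate (hφ : IsFlow φ) (t : ℝ) (n : ℕ) (x : X) : (φ t)^[n] x = φ (n * t) x := by
  induction n generalizing x with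
  | zero => simp [hφ.map_zero]
  | succ n ih =>
    rw [Function.iterate_succ_apply, ih, ← hφ.map_add]
    congr 1
    push_cast
    ring

/-- The integral of `f` along the orbit of `x` up to time `t`. -/
noncomputable def orbInt (φ : ℝ → X → X) (f : X → ℝ) (t : ℝ) (x : X) : ℝ :=
  ∫ τ in (0 : ℝ)..t, f (φ τ x)

variable {f : X → ℝ}

lemma continuous_orbInt (hφ : IsFlow φ) (hf : Continuous f) (t : ℝ) :
    Continuous (orbInt φ f t) := by
  unfold orbInt
  exact intervalIntegral.continuous_parametric_intervalIntegral_of_continuous'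
    (f := fun x τ => f (φ τ x)) (hf.comp (hφ.cont.comp continuous_swap)) 0 t

lemma orbInt_add (hφ : IsFlow φ) (hf : Continuous f) (s t : ℝ) (x : X) :
    orbInt φ f (s + t) x = orbInt φ f s x + orbInt φ f t (φ s x) := by
  have hi : ∀ a b, IntervalIntegrable (fun τ => f (φ τ x)) volume a b := fun a b =>
    (hf.comp (hφ.continuous_orbit x)).intervalIntegrable a b
  unfold orbInt
  simp only [← hφ.map_add]
  rw [intervalIntegral.integral_comp_add_right (fun τ => f (φ τ x)) s, zero_add, add_comm t s,
    intervalIntegral.integral_add_adjacent_intervals (hi _ _) (hi _ _)]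

lemma abs_orbInt_le {X : Type*} {φ : ℝ → X → X} {f : X → ℝ} {C : ℝ} (hC : ∀ x, |f x| ≤ C)
    (t : ℝ) (x : X) :
    |orbInt φ f t x| ≤ C * |t| := by
  have := intervalIntegral.norm_integral_le_of_norm_le_const (a := 0) (b := t)
    (f := fun τ => f (φ τ x)) (C := C) fun τ _ => by simpa using hC _
  simpa [orbInt] using this

lemma birkhoffSum_orbInt (hφ : IsFlow φ) (hf : Continuous f) (n : ℕ) (x : X) :
    birkhoffSum (φ 1) (orbInt φ f 1) n x = orbInt φ f n x := by
  induction n with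
  | zero => simp [orbInt]
  | succ n ih =>
    rw [birkhoffSum_succ, ih, hφ.iterate, Nat.cast_succ, orbInt_add hφ hf, mul_one]

end Topological

variable [MetricSpace X] [CompactSpace X] {f : X → ℝ}
variable [MeasurableSpace X] [BorelSpace X] {μ : Measure X} [IsProbabilityMeasure μ]

lemma integral_orbInt_one (hφ : IsFlow φ) (hinv : FlowInvariant φ μ) (hf : Continuous f) :
    ∫ x, orbInt φ f 1 x ∂μ = ∫ x, f x ∂μ := by
  have hcont : Continuous (Function.uncurry fun (x : X) (τ : ℝ) => f (φ τ x)) :=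
    hf.comp (hφ.cont.comp continuous_swap)
  obtain ⟨C, hC⟩ := isCompact_univ.exists_bound_of_continuousOn hf.continuousOn
  unfold orbInt
  simp only [intervalIntegral.integral_of_le zero_le_one]
  rw [integral_integral_swap]
  · have : ∀ τ, ∫ x, f (φ τ x) ∂μ = ∫ x, f x ∂μ := fun τ => by
      rw [← integral_map (f := f) (hinv τ).measurable.aemeasurable
        hf.aestronglyMeasurable, (hinv τ).map_eq]
    simp [this]
  · exact Integrable.of_bound hcont.aestronglyMeasurable C
      (ae_of_all _ fun p => hC _ (mem_univ _))

lemma ae_eventually_orbInt_le (hφ : IsFlow φ) (herg : FlowErgodic φ μ) (hf : Continuous f)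
    {a : ℝ} (ha : ∫ x, f x ∂μ < a) :
    ∀ᵐ x ∂μ, ∀ k : ℕ, ∀ᶠ n : ℕ in atTop, orbInt φ f n x ≤ n * (a + 1 / (k + 1)) := by
  obtain ⟨C, hC⟩ := isCompact_univ.exists_bound_of_continuousOn hf.continuousOn
  replace hC : ∀ x, |f x| ≤ C := fun x => hC x (mem_univ x)
  set E : Set X := {x | ∃ k : ℕ, ∃ᶠ n : ℕ in atTop, n * (a + 1 / (k + 1)) < orbInt φ f n x}
    with hE
  have hEm : MeasurableSet E := by
    have : E = ⋃ k : ℕ, ⋂ N : ℕ, ⋃ n : ℕ, ⋃ _ : N ≤ n,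
        {x | n * (a + 1 / (k + 1)) < orbInt φ f n x} := by
      ext x; simp [hE, frequently_atTop]
    rw [this]
    refine MeasurableSet.iUnion fun k => MeasurableSet.iInter fun N => MeasurableSet.iUnion
      fun n => MeasurableSet.iUnion fun _ => ?_
    exact (isOpen_lt continuous_const (continuous_orbInt hφ hf n)).measurableSet
  have hsub : ∀ t x, x ∈ E → φ t x ∈ E := by
    rintro t x ⟨k, hk⟩
    refine ⟨k + 1, ?_⟩
    have hev : ∀ᶠ n : ℕ in atTop,
        2 * (C * |t|) ≤ n * (1 / ((k : ℝ) + 1) - 1 / ((k : ℝ) + 1 + 1)) := by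
      refine (tendsto_natCast_atTop_atTop.atTop_mul_const ?_).eventually_ge_atTop _
      rw [sub_pos]
      exact one_div_lt_one_div_of_lt (by positivity) (by linarith)
    refine (hk.and_eventually hev).mono fun n ⟨h1, h2⟩ => ?_
    have e1 := orbInt_add hφ hf t n x
    have e2 := orbInt_add hφ hf n t x
    rw [add_comm] at e2
    have b1 := abs_le.1 (abs_orbInt_le (φ := φ) hC t x)
    have b2 := abs_le.1 (abs_orbInt_le (φ := φ) hC t (φ n x))
    push_cast
    linarith
  have hinvE : ∀ t, φ t ⁻¹' E = E := by
    intro t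
    ext x
    refine ⟨fun hx => ?_, fun hx => hsub t x hx⟩
    have := hsub (-t) _ hx
    rwa [← hφ.map_add, neg_add_cancel, hφ.map_zero] at this
  have hE0 : μ E = 0 := by
    refine (herg.2 E hEm hinvE).resolve_right fun h1 => ?_
    have hcont := continuous_orbInt hφ hf 1
    have hbd : ∀ x, |orbInt φ f 1 x| ≤ C := fun x => by
      simpa using abs_orbInt_le (φ := φ) hC 1 x
    have hinteg : Integrable (orbInt φ f 1) μ :=
      Integrable.of_bound hcont.aestronglyMeasurable C (ae_of_all _ hbd)
    have hfC : -C ≤ ∫ x, f x ∂μ := by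
      rw [← integral_orbInt_one hφ herg.1 hf]
      calc -C = ∫ _x, -C ∂μ := by simp
        _ ≤ _ := integral_mono (integrable_const _) hinteg fun x => (abs_le.1 (hbd x)).1
    have := le_integral_of_birkhoffSum_ge (herg.1 1) (f := fun x => orbInt φ f 1 x + C) (c := a + C)
      (hcont.measurable.add_const _) (hinteg.add (integrable_const C))
      (fun x => by linarith [(abs_le.1 (hbd x)).1]) (by linarith) ?_
    · rw [integral_add hinteg (integrable_const C), integral_orbInt_one hφ herg.1 hf] at this
      simp at this
      linarith
    · have hae : ∀ᵐ x ∂μ, x ∈ E := (mem_ae_iff_prob_eq_one hEm).2 h1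
      filter_upwards [hae] with x ⟨k, hk⟩
      obtain ⟨n, hn, hn1⟩ := (hk.and_eventually (eventually_ge_atTop 1)).exists
      refine ⟨n, hn1, ?_⟩
      have e : birkhoffSum (φ 1) (fun x => orbInt φ f 1 x + C) n x = orbInt φ f n x + n * C := by
        rw [← birkhoffSum_orbInt hφ hf]
        simp [birkhoffSum, Finset.sum_add_distrib]
      rw [e]
      have : (0 : ℝ) ≤ n * (1 / (k + 1)) := by positivity
      linarith
  filter_upwards [measure_eq_zero_iff_ae_notMem.1 hE0] with x hx k
  have : ¬ ∃ᶠ n : ℕ in atTop, n * (a + 1 / (k + 1)) < orbInt φ f n x := fun h => hx ⟨k, h⟩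
  simpa [not_frequently] using this

lemma ae_eventually_orbInt_le_add (hφ : IsFlow φ) (herg : FlowErgodic φ μ) (hf : Continuous f) :
    ∀ᵐ x ∂μ, ∀ k : ℕ, ∀ᶠ n : ℕ in atTop,
      orbInt φ f n x ≤ n * (∫ y, f y ∂μ + 2 / (k + 1)) := by
  have : ∀ᵐ x ∂μ, ∀ j k : ℕ, ∀ᶠ n : ℕ in atTop,
      orbInt φ f n x ≤ n * (∫ y, f y ∂μ + 1 / (j + 1) + 1 / (k + 1)) :=
    ae_all_iff.2 fun j => ae_eventually_orbInt_le hφ herg hf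
      (lt_add_of_pos_right _ (by positivity))
  filter_upwards [this] with x hx k
  filter_upwards [hx k k] with n hn
  convert hn using 2
  ring

/-- The pointwise ergodic theorem for a continuous observable of an ergodic flow. -/
lemma ae_tendsto_orbInt (hφ : IsFlow φ) (herg : FlowErgodic φ μ) (hf : Continuous f) :
    ∀ᵐ x ∂μ, Tendsto (fun t : ℝ => (1 / t) * orbInt φ f t x) atTop (𝓝 (∫ y, f y ∂μ)) := by
  obtain ⟨C, hC⟩ := isCompact_univ.exists_bound_of_continuousOn hf.continuousOn
  replace hC : ∀ x, |f x| ≤ C := fun x => hC x (mem_univ x)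
  filter_upwards [ae_eventually_orbInt_le_add hφ herg hf,
    ae_eventually_orbInt_le_add hφ herg hf.neg] with x h1 h2
  have hneg : ∀ t, orbInt φ (fun y => -f y) t x = -orbInt φ f t x := fun t => by
    simp [orbInt]
  have hnat : Tendsto (fun n : ℕ => orbInt φ f n x / n) atTop (𝓝 (∫ y, f y ∂μ)) := by
    rw [Metric.tendsto_nhds]
    intro ε hε
    obtain ⟨k, hk⟩ := exists_nat_one_div_lt (half_pos hε)
    filter_upwards [h1 k, h2 k, eventually_gt_atTop 0] with n b1 b2 hn
    have hn' : (0 : ℝ) < n := by exact_mod_cast hn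
    rw [show (-f : X → ℝ) = fun y => -f y from rfl, hneg] at b2
    rw [integral_neg] at b2
    have e : (2 : ℝ) / (k + 1) = 2 * (1 / (k + 1)) := by ring
    rw [e] at b1 b2
    rw [Real.dist_eq, abs_lt]
    constructor
    · have : (∫ y, f y ∂μ - 2 * (1 / (k + 1))) ≤ orbInt φ f n x / n := by
        rw [le_div_iff₀ hn']; linarith
      linarith
    · have : orbInt φ f n x / n ≤ (∫ y, f y ∂μ + 2 * (1 / (k + 1))) := by
        rw [div_le_iff₀ hn']; linarith
      linarith
  have hfl := hnat.comp (tendsto_nat_floor_atTop (α := ℝ))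
  have hmul := hfl.mul (tendsto_nat_floor_div_atTop (R := ℝ))
  rw [mul_one] at hmul
  have hrem : Tendsto (fun t : ℝ => (1 / t) * orbInt φ f (t - ⌊t⌋₊) (φ ⌊t⌋₊ x)) atTop (𝓝 0) := by
    have hinv : Tendsto (fun t : ℝ => t⁻¹ * C) atTop (𝓝 0) := by
      simpa using tendsto_inv_atTop_zero.mul_const C
    refine squeeze_zero_norm' ?_ hinv
    filter_upwards [eventually_gt_atTop 0] with t ht
    rw [norm_mul, Real.norm_eq_abs, Real.norm_eq_abs, one_div, abs_of_pos (inv_pos.2 ht)]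
    refine mul_le_mul_of_nonneg_left ?_ (inv_pos.2 ht).le
    refine (abs_orbInt_le hC _ _).trans ?_
    have hfloor := Nat.floor_le ht.le
    have hfloor' := Nat.lt_floor_add_one t
    have hC0 : 0 ≤ C := (abs_nonneg _).trans (hC x)
    refine mul_le_of_le_one_right hC0 ?_
    rw [abs_of_nonneg (by linarith)]
    linarith
  have := hmul.add hrem
  rw [add_zero] at this
  refine this.congr' ?_
  filter_upwards [eventually_ge_atTop 1] with t ht
  have hfl0 : (0 : ℝ) < ⌊t⌋₊ := by exact_mod_cast Nat.floor_pos.2 ht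
  have e := orbInt_add hφ hf ⌊t⌋₊ (t - ⌊t⌋₊) x
  rw [add_sub_cancel] at e
  simp only [Function.comp]
  rw [e]
  field_simp

/-- Almost every point is generic for an ergodic measure. -/
lemma ae_mem_genericPts (hφ : IsFlow φ) (herg : FlowErgodic φ μ) :
    ∀ᵐ x ∂μ, x ∈ genericPts φ μ := by
  obtain ⟨D, hDc, hD⟩ := TopologicalSpace.exists_countable_dense C(X, ℝ)
  have hall : ∀ᵐ x ∂μ, ∀ g ∈ D,
      Tendsto (fun t : ℝ => (1 / t) * orbInt φ g t x) atTop (𝓝 (∫ y, g y ∂μ)) :=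
    (ae_ball_iff hDc).2 fun g _ => ae_tendsto_orbInt hφ herg g.continuous
  filter_upwards [hall] with x hx
  intro f
  rw [Metric.tendsto_nhds]
  intro ε hε
  obtain ⟨g, hgD, hg⟩ := hD.exists_dist_lt f (show 0 < ε / 3 by positivity)
  have hfg : ∀ y, |f y - g y| ≤ ε / 3 := fun y =>
    ((ContinuousMap.dist_apply_le_dist y).trans hg.le)
  have hinteg : ∀ h : C(X, ℝ), Integrable h μ := fun h =>
    Integrable.of_bound h.continuous.aestronglyMeasurable ‖h‖
      (ae_of_all _ fun y => h.norm_coe_le_norm y)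
  have hI : |∫ y, f y ∂μ - ∫ y, g y ∂μ| ≤ ε / 3 := by
    rw [← integral_sub (hinteg f) (hinteg g)]
    have := norm_integral_le_of_norm_le_const (μ := μ) (f := fun y => f y - g y)
      (C := ε / 3) (ae_of_all _ hfg)
    simpa using this
  filter_upwards [(Metric.tendsto_nhds.1 (hx g hgD)) (ε / 3) (by positivity),
    eventually_gt_atTop 0] with t ht ht0
  have hO : |1 / t * orbInt φ f t x - 1 / t * orbInt φ g t x| ≤ ε / 3 := by
    have e : orbInt φ f t x - orbInt φ g t x = orbInt φ (fun y => f y - g y) t x := by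
      unfold orbInt
      rw [intervalIntegral.integral_sub]
      · exact (f.continuous.comp (hφ.continuous_orbit x)).intervalIntegrable _ _
      · exact (g.continuous.comp (hφ.continuous_orbit x)).intervalIntegrable _ _
    rw [← mul_sub, e, abs_mul, abs_of_pos (one_div_pos.2 ht0)]
    have := abs_orbInt_le (φ := φ) (f := fun y => f y - g y) hfg t x
    rw [abs_of_pos ht0] at this
    rw [one_div, inv_mul_le_iff₀ ht0]
    linarith
  change dist (1 / t * orbInt φ f t x) _ < ε
  rw [Real.dist_eq] at ht ⊢
  rw [abs_lt] at ht ⊢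
  rw [abs_le] at hO hI
  constructor <;> linarith

end Flow

lemma integral_comp_eq_sum [MeasurableSpace X] (μ : Measure X) [IsProbabilityMeasure μ]
    {ι : Type*} [Fintype ι] [MeasurableSpace ι] [MeasurableSingletonClass ι] {Q : X → ι}
    (hQ : Measurable Q) (c : ι → ℝ) :
    ∫ x, c (Q x) ∂μ = ∑ i, μ.real (Q ⁻¹' {i}) * c i := by
  have : IsProbabilityMeasure (μ.map Q) := Measure.isProbabilityMeasure_map hQ.aemeasurable
  rw [← integral_map (f := c) hQ.aemeasurable (measurable_of_finite c).aestronglyMeasurable,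
    integral_fintype Integrable.of_finite]
  refine Finset.sum_congr rfl fun i _ => ?_
  rw [map_measureReal_apply hQ (measurableSet_singleton i), smul_eq_mul]

/-- There are finite partitions into small pieces with negligible boundary. -/
lemma exists_partition_of_small_diam [MetricSpace X] [CompactSpace X] [MeasurableSpace X]
    [BorelSpace X] (μ : Measure X) [IsProbabilityMeasure μ] {δ : ℝ} (hδ : 0 < δ) :
    ∃ (m : ℕ) (P : X → Fin m), Measurable P ∧ (∀ x y, P x = P y → dist x y < δ) ∧
      ∀ᵐ x ∂μ, ∀ᶠ y in 𝓝 x, P y = P x := by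
  have hr : ∀ x : X, ∃ r ∈ Ioo (0 : ℝ) (δ / 2), μ (frontier (Metric.ball x r)) = 0 := by
    intro x
    obtain ⟨r, h1, h2⟩ := exists_null_frontier_thickening μ {x} (half_pos hδ)
    rw [Metric.thickening_singleton] at h2
    exact ⟨r, h1, h2⟩
  choose r hr hnull using hr
  obtain ⟨t, ht⟩ := isCompact_univ.elim_finite_subcover (fun x => Metric.ball x (r x))
    (fun x => Metric.isOpen_ball) fun x _ => mem_iUnion.2 ⟨x, Metric.mem_ball_self (hr x).1⟩
  classical
  set e := Fintype.equivFin (t → Prop) with he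
  set code : X → t → Prop := fun x i => x ∈ Metric.ball (i : X) (r i) with hcode
  refine ⟨_, fun x => e (code x), ?_, ?_, ?_⟩
  · refine measurable_to_countable' fun j => ?_
    have : (fun x => e (code x)) ⁻¹' {j} = ⋂ i : t, {x | code x i = e.symm j i} := by
      ext x
      simp [← Equiv.eq_symm_apply, funext_iff]
    rw [this]
    refine MeasurableSet.iInter fun i => ?_
    by_cases h : e.symm j i
    · have e' : {x | code x i = e.symm j i} = Metric.ball (i : X) (r i) := by
        ext x; simp only [mem_ofPred_eq, h, eq_iff_iff, iff_true]; rfl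
      rw [e']
      exact Metric.isOpen_ball.measurableSet
    · have e' : {x | code x i = e.symm j i} = (Metric.ball (i : X) (r i))ᶜ := by
        ext x; simp only [mem_ofPred_eq, h, eq_iff_iff, iff_false]; rfl
      rw [e']
      exact Metric.isOpen_ball.measurableSet.compl
  · intro x y hxy
    have hxy' : code x = code y := e.injective hxy
    obtain ⟨i, hi, hx⟩ := mem_iUnion₂.1 (ht (mem_univ x))
    have hy : code y ⟨i, hi⟩ := by rw [← hxy']; exact hx
    have h1 : dist x i < r i := hx
    have h2 : dist y i < r i := hy
    have h3 := (hr i).2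
    have h4 := dist_triangle_right x y i
    linarith
  · have hae : ∀ᵐ x ∂μ, ∀ i : t, x ∉ frontier (Metric.ball (i : X) (r i)) :=
      ae_all_iff.2 fun i => measure_eq_zero_iff_ae_notMem.1 (hnull i)
    filter_upwards [hae] with x hx
    have : ∀ i : t, ∀ᶠ y in 𝓝 x, code y i = code x i := by
      intro i
      set B := Metric.ball (i : X) (r i) with hB
      by_cases h : x ∈ B
      · filter_upwards [Metric.isOpen_ball.mem_nhds h] with y hy
        exact propext ⟨fun _ => h, fun _ => hy⟩
      · have h' : x ∉ closure B := fun hc => hx i ⟨hc, fun hi => h (interior_subset hi)⟩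
        filter_upwards [isClosed_closure.isOpen_compl.mem_nhds h'] with y hy
        exact propext ⟨fun hc => absurd (subset_closure hc) hy, fun hc => absurd hc h⟩
    filter_upwards [eventually_all.2 this] with y hy
    exact congrArg e (funext hy)

/-- Empirical measure of an orbit segment. -/
noncomputable def empirical [MeasurableSpace X] (φ : ℝ → X → X) (x : X) (t : ℝ) : Measure X :=
  (ENNReal.ofReal t)⁻¹ • (volume.restrict (Ioc 0 t)).map fun τ => φ τ x

section Flow

variable [MetricSpace X] [MeasurableSpace X] [BorelSpace X] {φ : ℝ → X → X}

lemma isProbabilityMeasure_empirical (hφ : IsFlow φ) (x : X) {t : ℝ} (ht : 0 < t) :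
    IsProbabilityMeasure (empirical φ x t) := by
  constructor
  rw [empirical, Measure.smul_apply, Measure.map_apply (hφ.continuous_orbit x).measurable
    MeasurableSet.univ]
  simp only [preimage_univ, Measure.restrict_apply_univ, Real.volume_Ioc, sub_zero, smul_eq_mul]
  exact ENNReal.inv_mul_cancel (by simpa using ht) ENNReal.ofReal_ne_top

lemma integral_empirical (hφ : IsFlow φ) (x : X) {t : ℝ} (ht : 0 < t) {f : X → ℝ}
    (hf : Measurable f) :
    ∫ y, f y ∂(empirical φ x t) = (1 / t) * ∫ τ in (0 : ℝ)..t, f (φ τ x) := by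
  rw [empirical, integral_smul_measure, integral_map (hφ.continuous_orbit x).aemeasurable
    hf.aestronglyMeasurable, intervalIntegral.integral_of_le ht.le]
  simp [ht.le]

lemma tendsto_average_of_mem_genericPts [CompactSpace X] (hφ : IsFlow φ) {μ : Measure X}
    [IsProbabilityMeasure μ] {ι : Type*} [Fintype ι] [MeasurableSpace ι]
    [MeasurableSingletonClass ι] {Q : X → ι} (hQ : Measurable Q)
    (hloc : ∀ᵐ x ∂μ, ∀ᶠ y in 𝓝 x, Q y = Q x) (c : ι → ℝ) {x : X} (hx : x ∈ genericPts φ μ)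
    {u : ℕ → ℝ} (hu0 : ∀ n, 0 < u n) (hu : Tendsto u atTop atTop) :
    Tendsto (fun n => (1 / u n) * ∫ τ in (0 : ℝ)..u n, c (Q (φ τ x))) atTop
      (𝓝 (∑ i, μ.real (Q ⁻¹' {i}) * c i)) := by
  let ν : ℕ → ProbabilityMeasure X := fun n =>
    ⟨empirical φ x (u n), isProbabilityMeasure_empirical hφ x (hu0 n)⟩
  let μ' : ProbabilityMeasure X := ⟨μ, inferInstance⟩
  have hν : Tendsto ν atTop (𝓝 μ') := by
    rw [ProbabilityMeasure.tendsto_iff_forall_integral_tendsto]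
    intro f
    have := (hx f.toContinuousMap).comp hu
    refine this.congr fun n => ?_
    exact (integral_empirical hφ x (hu0 n) f.continuous.measurable).symm
  have hfr : ∀ i, μ (frontier (Q ⁻¹' {i})) = 0 := by
    intro i
    refine measure_mono_null ?_ (ae_iff.1 hloc)
    intro y hy hloc'
    by_cases h : Q y = i
    · refine hy.2 (mem_interior_iff_mem_nhds.2 ?_)
      filter_upwards [hloc'] with z hz
      exact hz.trans h
    · refine (mem_closure_iff_frequently.1 hy.1) ?_
      filter_upwards [hloc'] with z hz hz'
      exact h (hz.symm.trans hz')
  have hmeas : ∀ i, Tendsto (fun n => (empirical φ x (u n)).real (Q ⁻¹' {i})) atTop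
      (𝓝 (μ.real (Q ⁻¹' {i}))) := by
    intro i
    have := ProbabilityMeasure.tendsto_measure_of_null_frontier_of_tendsto' hν
      (E := Q ⁻¹' {i}) (hfr i)
    exact (ENNReal.tendsto_toReal (measure_ne_top _ _)).comp this
  have hsum := tendsto_finsetSum Finset.univ fun i _ => (hmeas i).mul_const (c i)
  refine hsum.congr fun n => ?_
  have := isProbabilityMeasure_empirical hφ x (hu0 n)
  rw [← integral_comp_eq_sum _ hQ]
  exact integral_empirical hφ x (hu0 n) ((measurable_of_finite c).comp hQ)

end Flow

/-- Some translate of an arithmetic progression sees at most the average of `h`. -/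
lemma exists_sum_le_of_integral_lt {h : ℝ → ℝ} (hh : ∀ a b, IntervalIntegrable h volume a b)
    {k : ℝ} (hk : 0 < k) {n : ℕ} {a : ℝ} (hlt : ∫ τ in (0 : ℝ)..n * k, h τ < n * k * a) :
    ∃ v ∈ Ico 0 k, ∑ j ∈ Finset.range n, h (v + j * k) ≤ n * a := by
  by_contra! hcon
  have hi : ∀ j : ℕ, IntervalIntegrable (fun v => h (v + j * k)) volume 0 k := fun j => by
    have := (hh (j * k) (k + j * k)).comp_add_right (j * k)
    simpa using this
  have hsplit : ∫ τ in (0 : ℝ)..n * k, h τ =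
      ∫ v in (0 : ℝ)..k, ∑ j ∈ Finset.range n, h (v + j * k) := by
    rw [intervalIntegral.integral_finsetSum fun j _ => hi j]
    have := intervalIntegral.sum_integral_adjacent_intervals (f := h) (μ := volume)
      (a := fun j : ℕ => j * k) (n := n) fun j _ => hh _ _
    simp only [Nat.cast_zero, zero_mul] at this
    rw [← this]
    refine Finset.sum_congr rfl fun j _ => ?_
    rw [intervalIntegral.integral_comp_add_right]
    congr 1 <;> push_cast <;> ring
  have hge : ∫ _v in (0 : ℝ)..k, (n * a : ℝ) ≤
      ∫ v in (0 : ℝ)..k, ∑ j ∈ Finset.range n, h (v + j * k) := by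
    refine intervalIntegral.integral_mono_on_of_le_Ioo hk.le (by simp) ?_ fun v hv =>
      (hcon v ⟨hv.1.le, hv.2⟩).le
    have := IntervalIntegrable.sum (Finset.range n) fun j _ => hi j
    simpa only [Finset.sum_fn] using this
  rw [← hsplit, intervalIntegral.integral_const, smul_eq_mul] at hge
  linarith

lemma card_mul_exp_le_one {ι : Type*} [Fintype ι] {q : ι → ℝ} (hq : IsSubProb q) (n : ℕ)
    (a : ℝ) (S : Finset (Fin n → ι)) (hS : ∀ ω ∈ S, Real.exp (-(n * a)) ≤ ∏ j, q (ω j)) :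
    S.card * Real.exp (-(n * a)) ≤ 1 := by
  classical
  calc S.card * Real.exp (-(n * a)) = ∑ _ω ∈ S, Real.exp (-(n * a)) := by simp
    _ ≤ ∑ ω ∈ S, ∏ j, q (ω j) := Finset.sum_le_sum hS
    _ ≤ ∑ ω : Fin n → ι, ∏ j, q (ω j) := Finset.sum_le_sum_of_subset_of_nonneg
        (Finset.subset_univ _) fun ω _ _ => Finset.prod_nonneg fun j _ => hq.1 _
    _ = (∑ i, q i) ^ n := (Fintype.sum_pow q n).symm
    _ ≤ 1 := pow_le_one₀ (Finset.sum_nonneg fun i _ => hq.1 i) hq.2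

/-- Letter probabilities that are all positive and whose cross entropy with the distribution of
`Q` is close to the entropy of `Q`. -/
lemma exists_pos_subProb [MeasurableSpace X] (μ : Measure X) [IsProbabilityMeasure μ]
    {ι : Type*} [Fintype ι] [Nonempty ι] [MeasurableSpace ι] [MeasurableSingletonClass ι]
    {Q : X → ι} (hQ : Measurable Q) {a : ℝ} (ha : partEnt μ Q < a) :
    ∃ q : ι → ℝ, IsSubProb q ∧ (∀ i, 0 < q i) ∧
      ∑ i, μ.real (Q ⁻¹' {i}) * (-Real.log (q i)) < a := by
  set p : ι → ℝ := fun i => μ.real (Q ⁻¹' {i}) with hp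
  have hp0 : ∀ i, 0 ≤ p i := fun i => measureReal_nonneg
  have hp1 : ∑ i, p i = 1 := by
    have := integral_comp_eq_sum μ hQ fun _ => 1
    simpa using this.symm
  set gap := (a - partEnt μ Q) / 2 with hgap
  have hgap0 : 0 < gap := by rw [hgap]; linarith
  set K : ℝ := (Fintype.card ι : ℝ) with hK
  have hK0 : 0 < K := by rw [hK]; exact_mod_cast Fintype.card_pos
  set η : ℝ := (Real.exp gap - 1) / K with hη
  have hη0 : 0 < η := div_pos (by linarith [Real.add_one_lt_exp hgap0.ne']) hK0
  have hηK : 1 + K * η = Real.exp gap := by rw [hη]; field_simp; ring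
  refine ⟨fun i => (p i + η) / Real.exp gap, ⟨fun i => ?_, ?_⟩, fun i => ?_, ?_⟩
  · have := hp0 i
    positivity
  · rw [← Finset.sum_div, Finset.sum_add_distrib, hp1]
    simp only [Finset.sum_const, Finset.card_univ, nsmul_eq_mul]
    rw [← hK, hηK, div_self (Real.exp_pos _).ne']
  · have := hp0 i
    positivity
  · have key : ∀ i, p i * (-Real.log ((p i + η) / Real.exp gap)) ≤
        Real.negMulLog (p i) + p i * gap := by
      intro i
      rcases (hp0 i).eq_or_lt with h0 | h0
      · simp [← h0]
      · rw [Real.log_div (by positivity) (Real.exp_pos _).ne', Real.log_exp, Real.negMulLog]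
        have := Real.log_le_log h0 (le_add_of_nonneg_right hη0.le : p i ≤ p i + η)
        nlinarith
    calc _ ≤ ∑ i, (Real.negMulLog (p i) + p i * gap) := Finset.sum_le_sum fun i _ => key i
      _ = partEnt μ Q + gap := by
        rw [Finset.sum_add_distrib, ← Finset.sum_mul, hp1, one_mul]
        rfl
      _ < a := by rw [hgap]; linarith

lemma coverM_le_of_family [PseudoMetricSpace X] {φ : ℝ → X → X} {Z : Set X} {s ε : ℝ} {N : ℕ}
    {α : Type*} [Countable α] (z : α → X × ℝ) (hN : ∀ i, (N : ℝ) ≤ (z i).2)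
    (hZ : ∀ x ∈ Z, ∃ i, x ∈ reparBall φ (z i).1 (z i).2 ε) :
    coverM φ Z s N ε ≤ ∑' i, ENNReal.ofReal (Real.exp (-s * (z i).2)) := by
  refine (iInf₂_le_of_le (range z) (countable_range z) ?_)
  refine (iInf₂_le_of_le (by rintro _ ⟨i, rfl⟩; exact hN i) ?_ ?_)
  · intro x hx
    obtain ⟨i, hi⟩ := hZ x hx
    exact mem_iUnion₂.2 ⟨z i, mem_range_self i, hi⟩
  · have := ENNReal.tsum_comp_le_tsum_of_injective (rangeSplitting_injective z)
      fun i => ENNReal.ofReal (Real.exp (-s * (z i).2))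
    simpa only [apply_rangeSplitting] using this

lemma mem_reparBall_of_dist_lt [PseudoMetricSpace X] {φ : ℝ → X → X} {x y : X} {t ε : ℝ}
    (h : ∀ s ∈ Icc (0 : ℝ) t, dist (φ s x) (φ s y) < ε) : y ∈ reparBall φ x t ε :=
  ⟨id, ⟨continuousOn_id, injOn_id _, rfl⟩, h⟩

lemma exists_lt_mul_le {k u : ℝ} {n : ℕ} (hn : 0 < n) (hu0 : 0 ≤ u) (hu : u ≤ n * k) :
    ∃ j < n, j * k ≤ u ∧ u ≤ (j + 1) * k := by
  induction n with
  | zero => exact absurd hn (lt_irrefl _)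
  | succ n ih =>
    by_cases h : 0 < n ∧ u ≤ n * k
    · obtain ⟨j, hj, h'⟩ := ih h.1 h.2
      exact ⟨j, by omega, h'⟩
    · refine ⟨n, by omega, ?_, by simpa using hu⟩
      rcases Nat.eq_zero_or_pos n with rfl | hn'
      · simpa using hu0
      · exact (not_le.1 fun hle => h ⟨hn', hle⟩).le

section Flow

variable [MetricSpace X] {φ : ℝ → X → X}

/-- Points whose orbits, sampled with step `k` from nearby starting times `v` and `v'`, have the
same itinerary stay close to each other. -/
lemma dist_lt_of_same_itinerary (hφ : IsFlow φ) {k : ℝ} (hk : 0 < k) {ε r : ℝ} {ι : Type*}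
    {Q : X → ι} (hQ : ∀ x y, Q x = Q y → ∀ s ∈ Icc 0 k, dist (φ s x) (φ s y) < ε / 2)
    (hr : ∀ s, |s| ≤ r → ∀ x, dist (φ s x) x < ε / 2) {x y : X} (hxy : Q x = Q y) {v v' : ℝ}
    (hv : v ∈ Ico 0 k) (hvv : |v - v'| ≤ r) {n : ℕ}
    (h : ∀ j < n, Q (φ (v + j * k) x) = Q (φ (v' + j * k) y)) (s : ℝ) (hs : s ∈ Icc 0 (n * k)) :
    dist (φ s x) (φ s y) < ε := by
  rcases lt_or_ge s k with hsk | hsk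
  · have h1 := hQ x y hxy s ⟨hs.1, hsk.le⟩
    linarith [dist_nonneg.trans_lt h1]
  · have hn : 0 < n := by
      rcases Nat.eq_zero_or_pos n with rfl | hn
      · have := hs.2
        simp only [Nat.cast_zero, zero_mul] at this
        linarith
      · exact hn
    obtain ⟨j, hjn, hj1, hj2⟩ := exists_lt_mul_le (u := s - v) (k := k) hn
      (by linarith [hv.2]) (by linarith [hs.2, hv.1])
    have h1 := hQ _ _ (h j hjn) (s - v - j * k) ⟨by linarith, by linarith⟩
    rw [← hφ.map_add, ← hφ.map_add] at h1
    have e1 : s - v - j * k + (v + j * k) = s := by ring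
    have e2 : s - v - j * k + (v' + j * k) = -(v - v') + s := by ring
    rw [e1, e2, hφ.map_add] at h1
    have h2 := hr (-(v - v')) (by rwa [abs_neg]) (φ s y)
    linarith [dist_triangle (φ s x) (φ (-(v - v')) (φ s y)) (φ s y)]

end Flow

section Uniform

variable [MetricSpace X] [CompactSpace X] {φ : ℝ → X → X}

lemma IsFlow.exists_dist_lt (hφ : IsFlow φ) {ε : ℝ} (hε : 0 < ε) :
    ∃ r > 0, ∀ s, |s| ≤ r → ∀ x, dist (φ s x) x < ε := by
  have hc : Continuous fun p : ℝ × X => dist (φ p.1 p.2) p.2 := hφ.cont.dist continuous_snd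
  have hev : ∀ᶠ s in 𝓝 (0 : ℝ), ∀ x ∈ (univ : Set X), dist (φ s x) x < ε := by
    refine isCompact_univ.eventually_forall_of_forall_eventually fun x _ => ?_
    refine hc.continuousAt.eventually_lt continuousAt_const ?_
    simpa [hφ.map_zero] using hε
  obtain ⟨r, hr, h⟩ := Metric.eventually_nhds_iff.1 hev
  refine ⟨r / 2, half_pos hr, fun s hs x => h ?_ x (mem_univ x)⟩
  rw [Real.dist_eq, sub_zero]
  linarith

lemma IsFlow.exists_dist_flow_lt (hφ : IsFlow φ) (T : ℝ) {ε : ℝ} (hε : 0 < ε) :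
    ∃ δ > 0, ∀ x y, dist x y < δ → ∀ s ∈ Icc 0 T, dist (φ s x) (φ s y) < ε := by
  have huc := (isCompact_Icc.prod (isCompact_univ (X := X))).uniformContinuousOn_of_continuous
    (hφ.cont.continuousOn (s := Icc 0 T ×ˢ univ))
  obtain ⟨δ, hδ, h⟩ := Metric.uniformContinuousOn_iff.1 huc ε hε
  refine ⟨δ, hδ, fun x y hxy s hs => h (s, x) ⟨hs, mem_univ _⟩ (s, y) ⟨hs, mem_univ _⟩ ?_⟩
  simpa [Prod.dist_eq, hδ] using hxy

end Uniform

section Cover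

variable [MetricSpace X] [CompactSpace X] [MeasurableSpace X] [BorelSpace X] {φ : ℝ → X → X}

/-- A partition of small dynamical diameter and small entropy yields efficient covers of the set
of generic points. -/
lemma coverM_eq_zero_of_partEnt_lt (hφ : IsFlow φ) {μ : Measure X} [IsProbabilityMeasure μ]
    {ι : Type*} [Fintype ι] [MeasurableSpace ι] [MeasurableSingletonClass ι] {Q : X → ι}
    (hQm : Measurable Q) (hloc : ∀ᵐ x ∂μ, ∀ᶠ y in 𝓝 x, Q y = Q x) {k s ε : ℝ} (hk : 1 ≤ k)
    (hε : 0 < ε) (hQ : ∀ x y, Q x = Q y → ∀ s ∈ Icc 0 k, dist (φ s x) (φ s y) < ε / 2)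
    (hent : partEnt μ Q < k * s) (N : ℕ) : coverM φ (genericPts φ μ) s N ε = 0 := by
  classical
  have hk0 : 0 < k := zero_lt_one.trans_le hk
  have : Nonempty X := by
    by_contra hX
    rw [not_nonempty_iff] at hX
    exact IsProbabilityMeasure.ne_zero μ (Subsingleton.elim _ _)
  have : Nonempty ι := this.map Q
  obtain ⟨a, ha1, ha2⟩ := exists_between hent
  obtain ⟨q, hq, hqpos, hqa⟩ := exists_pos_subProb μ hQm ha1
  obtain ⟨r, hr0, hr⟩ : ∃ r > 0, ∀ s, |s| ≤ r → ∀ x, dist (φ s x) x < ε / 2 :=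
    hφ.exists_dist_lt (half_pos hε)
  set M : ℕ := ⌊k / r⌋₊ + 1 with hM
  let good : (n : ℕ) → Finset (Fin n → ι) := fun n =>
    Finset.univ.filter fun ω => Real.exp (-(n * a)) ≤ ∏ j, q (ω j)
  let Code : (n : ℕ) → Type _ := fun n => ι × Fin M × good n
  let Has : (n : ℕ) → Code n → X → Prop := fun n c x =>
    Q x = c.1 ∧ ∃ v ∈ Ico 0 k, ⌊v / r⌋₊ = c.2.1 ∧
      ∀ j : Fin n, Q (φ (v + j * k) x) = (c.2.2 : Fin n → ι) j
  let center : (n : ℕ) → Code n → X := fun n c => Classical.epsilon (Has n c)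
  have hball : ∀ n c x, Has n c x → x ∈ reparBall φ (center n c) (n * k) ε := by
    intro n c x hx
    obtain ⟨h1, v, hv, h2, h3⟩ : Has n c (center n c) := Classical.epsilon_spec ⟨x, hx⟩
    obtain ⟨h1', v', hv', h2', h3'⟩ := hx
    refine mem_reparBall_of_dist_lt (dist_lt_of_same_itinerary hφ hk0 hQ hr (h1.trans h1'.symm)
      hv ?_ (v' := v') (n := n) fun j hj => ?_)
    · have a1 := Nat.floor_le (div_nonneg hv.1 hr0.le)
      have a2 := Nat.lt_floor_add_one (v / r)
      have a3 := Nat.floor_le (div_nonneg hv'.1 hr0.le)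
      have a4 := Nat.lt_floor_add_one (v' / r)
      rw [h2, le_div_iff₀ hr0] at a1
      rw [h2, div_lt_iff₀ hr0] at a2
      rw [h2', le_div_iff₀ hr0] at a3
      rw [h2', div_lt_iff₀ hr0] at a4
      rw [abs_le]
      constructor <;> linarith
    · exact (h3 ⟨j, hj⟩).trans (h3' ⟨j, hj⟩).symm
  have hcov : ∀ x ∈ genericPts φ μ, ∀ᶠ n : ℕ in atTop, ∃ c, Has n c x := by
    intro x hx
    have hav := tendsto_average_of_mem_genericPts hφ hQm hloc (fun i => -Real.log (q i)) hx
      (u := fun n : ℕ => (n + 1 : ℕ) * k) (fun n => by positivity)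
      ((tendsto_natCast_atTop_atTop.comp (tendsto_add_atTop_nat 1)).atTop_mul_const hk0)
    have hev := hav.eventually_lt_const hqa
    rw [eventually_atTop] at hev ⊢
    obtain ⟨n0, hn0⟩ := hev
    refine ⟨n0 + 1, fun n hn => ?_⟩
    obtain ⟨m, rfl⟩ : ∃ m, n = m + 1 := ⟨n - 1, by omega⟩
    have hlt := hn0 m (by omega)
    have hpos : 0 < ((m + 1 : ℕ) : ℝ) * k := by positivity
    rw [one_div, inv_mul_lt_iff₀ hpos] at hlt
    have hii : ∀ a b, IntervalIntegrable (fun τ => -Real.log (q (Q (φ τ x)))) volume a b := by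
      intro a b
      have hmeas : Measurable fun τ => -Real.log (q (Q (φ τ x))) :=
        (measurable_of_finite fun i => -Real.log (q i)).comp
          (hQm.comp (hφ.continuous_orbit x).measurable)
      obtain ⟨C, hC⟩ := (finite_range fun i => |-Real.log (q i)|).bddAbove
      exact intervalIntegrable_const (c := C) |>.mono_fun' hmeas.aestronglyMeasurable
        (ae_of_all _ fun τ => hC (mem_range_self _))
    obtain ⟨v, hv, hsum⟩ := exists_sum_le_of_integral_lt hii hk0 hlt
    have hgood : (fun j : Fin (m + 1) => Q (φ (v + j * k) x)) ∈ good (m + 1) := by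
      simp only [good, Finset.mem_filter, Finset.mem_univ, true_and]
      rw [← Real.le_log_iff_exp_le (Finset.prod_pos fun j _ => hqpos _),
        Real.log_prod fun j _ => (hqpos _).ne']
      rw [Finset.sum_neg_distrib, Finset.sum_range] at hsum
      linarith
    have hvM : ⌊v / r⌋₊ < M := Nat.lt_succ_of_le (Nat.floor_le_floor
      (div_le_div_of_nonneg_right hv.2.le hr0.le))
    exact ⟨(Q x, ⟨_, hvM⟩, ⟨_, hgood⟩), rfl, v, hv, rfl, fun j => rfl⟩
  have hle : ∀ n0 : ℕ, N ≤ n0 → coverM φ (genericPts φ μ) s N ε ≤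
      Fintype.card ι * M * (ENNReal.ofReal (Real.exp (a - k * s)) ^ n0 *
        (1 - ENNReal.ofReal (Real.exp (a - k * s)))⁻¹) := by
    intro n0 hn0
    refine (coverM_le_of_family (α := Σ n : ℕ, Code (n0 + n))
      (fun i => (center _ i.2, (n0 + i.1 : ℕ) * k)) (fun i => ?_) fun x hx => ?_).trans ?_
    · have h1 : (N : ℝ) ≤ (n0 + i.1 : ℕ) := by exact_mod_cast hn0.trans (Nat.le_add_right _ _)
      have h2 : (0 : ℝ) ≤ (n0 + i.1 : ℕ) := Nat.cast_nonneg _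
      change (N : ℝ) ≤ (n0 + i.1 : ℕ) * k
      nlinarith
    · obtain ⟨n, hn⟩ := eventually_atTop.1 (hcov x hx)
      obtain ⟨c, hc⟩ := hn (n0 + n) (Nat.le_add_left _ _)
      exact ⟨⟨n, c⟩, hball _ c x hc⟩
    · rw [ENNReal.tsum_sigma', ← ENNReal.tsum_geometric, ← ENNReal.tsum_mul_left,
        ← ENNReal.tsum_mul_left]
      refine ENNReal.tsum_le_tsum fun n => ?_
      change ∑' _ : Code (n0 + n),
        ENNReal.ofReal (Real.exp (-s * (((n0 + n : ℕ) : ℝ) * k))) ≤ _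
      rw [tsum_fintype, Finset.sum_const, Finset.card_univ, nsmul_eq_mul, ← pow_add]
      have hcard := card_mul_exp_le_one hq (n0 + n) a (good (n0 + n)) fun ω hω => by
        simpa [good] using hω
      have hc : Fintype.card (Code (n0 + n)) = Fintype.card ι * (M * (good (n0 + n)).card) := by
        simp [Code]
      rw [hc]
      push_cast
      rw [mul_assoc, mul_assoc, mul_assoc]
      gcongr
      rw [← ENNReal.ofReal_natCast (good (n0 + n)).card, ← ENNReal.ofReal_mul (by positivity),
        ← ENNReal.ofReal_pow (Real.exp_pos _).le, ← Real.exp_nat_mul]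
      refine ENNReal.ofReal_le_ofReal ?_
      have e1 : Real.exp (-s * (((n0 + n : ℕ) : ℝ) * k)) =
          Real.exp (-((n0 + n : ℕ) * a)) * Real.exp ((n0 + n : ℕ) * (a - k * s)) := by
        rw [← Real.exp_add]
        congr 1
        ring
      push_cast at e1 hcard ⊢
      rw [e1, ← mul_assoc]
      exact mul_le_of_le_one_left (Real.exp_pos _).le hcard
  have hρ : ENNReal.ofReal (Real.exp (a - k * s)) < 1 := by
    rw [ENNReal.ofReal_lt_one, Real.exp_lt_one_iff]
    linarith
  have hlim : Tendsto (fun n0 : ℕ => (Fintype.card ι * M : ℝ≥0∞) *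
      (ENNReal.ofReal (Real.exp (a - k * s)) ^ n0 *
        (1 - ENNReal.ofReal (Real.exp (a - k * s)))⁻¹)) atTop (𝓝 0) := by
    have h1 := ENNReal.tendsto_pow_atTop_nhds_zero_of_lt_one hρ
    have h2 := ENNReal.Tendsto.mul_const h1
      (b := (1 - ENNReal.ofReal (Real.exp (a - k * s)))⁻¹)
      (Or.inr (ENNReal.inv_ne_top.2 (tsub_pos_of_lt hρ).ne'))
    have h3 := ENNReal.Tendsto.const_mul h2 (a := (Fintype.card ι * M : ℝ≥0∞))
      (Or.inr (ENNReal.mul_ne_top (ENNReal.natCast_ne_top _) (ENNReal.natCast_ne_top _)))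
    simpa using h3
  refine le_antisymm (ge_of_tendsto hlim ?_) zero_le
  filter_upwards [eventually_ge_atTop N] with n0 hn0 using hle n0 hn0

end Cover

section UpperBound

variable [MetricSpace X] [CompactSpace X] [MeasurableSpace X] [BorelSpace X] {φ : ℝ → X → X}

lemma coverMlim_genericPts_eq_zero (hφ : IsFlow φ) {μ : Measure X} [IsProbabilityMeasure μ]
    (hinv : FlowInvariant φ μ) {s : ℝ} (hs : kolSinai μ (φ 1) < ENNReal.ofReal s) :
    coverMlim φ (genericPts φ μ) s = 0 := by
  simp only [coverMlim, coverMeps, ENNReal.iSup_eq_zero]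
  intro ε hε N
  obtain ⟨δ, hδ, hδφ⟩ := hφ.exists_dist_flow_lt 1 (half_pos hε)
  obtain ⟨m, P, hP, hPδ, hloc⟩ := exists_partition_of_small_diam μ hδ
  have hlim := (le_iSup₂_of_le m P (le_iSup_of_le hP le_rfl) :
    _ ≤ kolSinai μ (φ 1)).trans_lt hs
  obtain ⟨k, hlt, hk⟩ := ((eventually_lt_of_limsup_lt hlim).and (eventually_ge_atTop 1)).exists
  have hk0 : (0 : ℝ) < k := by exact_mod_cast hk
  have hs0 : 0 < s := ENNReal.ofReal_pos.1 (zero_le.trans_lt hs)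
  rw [ENNReal.ofReal_lt_ofReal_iff hs0, div_lt_iff₀ hk0, mul_comm] at hlt
  have hiter : ∀ (j : ℕ) x, (φ 1)^[j] x = φ j x := fun j x => by
    rw [hφ.iterate, mul_one]
  refine coverM_eq_zero_of_partEnt_lt hφ (k := k) ?_ ?_ (by exact_mod_cast hk) hε ?_ hlt N
  · exact measurable_pi_lambda _ fun j =>
      hP.comp ((hinv 1).measurable.iterate j)
  · have h : ∀ j : Fin k, ∀ᵐ x ∂μ, ∀ᶠ y in 𝓝 x, P ((φ 1)^[j] y) = P ((φ 1)^[j] x) := by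
      intro j
      have h1 := ((hinv 1).iterate j).quasiMeasurePreserving.ae hloc
      filter_upwards [h1] with x hx
      exact (((hφ.continuous_time 1).iterate j).tendsto x).eventually hx
    filter_upwards [ae_all_iff.2 h] with x hx
    filter_upwards [eventually_all.2 hx] with y hy
    exact funext hy
  · intro x y hxy u hu
    obtain ⟨j, hj, hj1, hj2⟩ := exists_lt_mul_le (k := 1) (u := u) (n := k) hk hu.1
      (by simpa using hu.2)
    have h1 := hδφ _ _ (hPδ _ _ (congrFun hxy ⟨j, hj⟩)) (u - j) ⟨by linarith, by linarith⟩
    rwa [hiter, hiter, ← hφ.map_add, ← hφ.map_add, sub_add_cancel] at h1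

lemma bowenEntropy_genericPts_le (hφ : IsFlow φ) {μ : Measure X} [IsProbabilityMeasure μ]
    (hinv : FlowInvariant φ μ) : bowenEntropy φ (genericPts φ μ) ≤ kolSinai μ (φ 1) := by
  refine le_of_forall_gt_imp_ge_of_dense fun c hc => ?_
  obtain ⟨r, hr, hrc⟩ := ENNReal.lt_iff_exists_nnreal_btwn.1 hc
  rw [← ENNReal.ofReal_coe_nnreal] at hr hrc
  exact (iInf₂_le_of_le (r : ℝ) r.2
    (iInf_le_of_le (coverMlim_genericPts_eq_zero hφ hinv hr) le_rfl)).trans hrc.le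

end UpperBound

section Drift

variable [MetricSpace X] {φ : ℝ → X → X}

lemma IsFlow.map_int_mul_eq (hφ : IsFlow φ) {τ : ℝ} {z : X} (h : φ τ z = z) (n : ℤ) :
    φ (n * τ) z = z := by
  have hnat : ∀ m : ℕ, φ (m * τ) z = z := fun m => by
    rw [← hφ.iterate, Function.iterate_fixed h]
  obtain ⟨m, rfl | rfl⟩ := n.eq_nat_or_neg
  · exact_mod_cast hnat m
  · nth_rewrite 1 [← hnat m]
    rw [← hφ.map_add]
    have : ((-(m : ℤ) : ℤ) : ℝ) * τ + m * τ = 0 := by push_cast; ring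
    rw [this, hφ.map_zero]

lemma IsFlow.eventually_map_ne [CompactSpace X] (hφ : IsFlow φ) (hfp : FixedPointFree φ) :
    ∀ᶠ τ in 𝓝[>] (0 : ℝ), ∀ z, φ τ z ≠ z := by
  have hev : ∀ᶠ τ in 𝓝 (0 : ℝ), ∀ z ∈ (univ : Set X), 0 < τ → φ τ z ≠ z := by
    refine isCompact_univ.eventually_forall_of_forall_eventually fun z₀ _ => ?_
    obtain ⟨t, ht⟩ := hfp z₀
    obtain ⟨η, hη0, hη⟩ := exists_between (dist_pos.2 ht)
    obtain ⟨r, hr0, hr⟩ := hφ.exists_dist_lt hη0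
    have hc : Continuous fun z => dist (φ t z) z := (hφ.continuous_time t).dist continuous_id
    have h1 : ∀ᶠ z in 𝓝 z₀, η < dist (φ t z) z := hc.continuousAt.eventually_const_lt hη
    have h2 : ∀ᶠ τ in 𝓝 (0 : ℝ), τ < r := eventually_lt_nhds hr0
    rw [nhds_prod_eq]
    filter_upwards [h2.prod_mk h1] with p hp hτ hfix
    obtain ⟨hp1, hp2⟩ := hp
    have h3 := Int.floor_le (t / p.1)
    have h4 := Int.lt_floor_add_one (t / p.1)
    rw [le_div_iff₀ hτ] at h3
    rw [div_lt_iff₀ hτ] at h4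
    have h5 := hr (t - ⌊t / p.1⌋ * p.1) (abs_le.2 ⟨by linarith, by linarith⟩) p.2
    rw [← hφ.map_int_mul_eq hfix ⌊t / p.1⌋, ← hφ.map_add, sub_add_cancel,
      hφ.map_int_mul_eq hfix] at h5
    linarith
  filter_upwards [nhdsWithin_le_nhds hev, self_mem_nhdsWithin] with τ h hτ z
  exact h z (mem_univ z) hτ

/-- A flow without fixed points displaces all points by a definite amount in any small time. -/
lemma IsFlow.exists_le_dist_map [CompactSpace X] (hφ : IsFlow φ) (hfp : FixedPointFree φ) {r : ℝ}
    (hr : 0 < r) : ∃ τ > 0, τ ≤ r ∧ ∃ γ > 0, ∀ s z, |s| = τ → γ ≤ dist (φ s z) z := by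
  have h1 : ∀ᶠ τ in 𝓝[>] (0 : ℝ), τ < r := nhdsWithin_le_nhds (eventually_lt_nhds hr)
  obtain ⟨τ, ⟨hne, hτr⟩, hτ⟩ :=
    (((hφ.eventually_map_ne hfp).and h1).and self_mem_nhdsWithin).exists
  refine ⟨τ, hτ, hτr.le, ?_⟩
  have hc : Continuous fun z => dist (φ τ z) z := (hφ.continuous_time τ).dist continuous_id
  rcases isEmpty_or_nonempty X with hX | hX
  · exact ⟨1, one_pos, fun s z => isEmptyElim z⟩
  obtain ⟨z₀, -, hz₀⟩ := isCompact_univ.exists_isMinOn univ_nonempty hc.continuousOn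
  replace hz₀ : ∀ z, dist (φ τ z₀) z₀ ≤ dist (φ τ z) z := fun z => hz₀ (mem_univ z)
  refine ⟨_, dist_pos.2 (hne z₀), fun s z hs => ?_⟩
  rcases eq_or_eq_neg_of_abs_eq hs with rfl | rfl
  · exact hz₀ z
  · have := hz₀ (φ (-τ) z)
    rwa [← hφ.map_add, add_neg_cancel, hφ.map_zero, dist_comm z] at this

lemma abs_drift_lt (hφ : IsFlow φ) {T τ γ ε : ℝ} (hγ : ∀ s z, |s| = τ → γ ≤ dist (φ s z) z)
    (hτ : 0 < τ) (hε : ε ≤ γ / 2)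
    (hεT : ∀ x y, dist x y < ε → ∀ s ∈ Icc 0 T, dist (φ s x) (φ s y) < γ / 2) {x y : X} {t : ℝ}
    {α : ℝ → ℝ} (hα : ContinuousOn α (Icc 0 t))
    (hxy : ∀ s ∈ Icc (0 : ℝ) t, dist (φ (α s) x) (φ s y) < ε) {u v : ℝ} (hu : 0 ≤ u) (huv : u ≤ v)
    (hvt : v ≤ t) (hvT : v ≤ u + T) : |α v - v - (α u - u)| < τ := by
  by_contra! hcon
  have hc : ContinuousOn (fun w => |α w - w - (α u - u)|) (Icc u v) :=
    (((hα.mono (Icc_subset_Icc hu hvt)).sub continuousOn_id).sub continuousOn_const).abs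
  obtain ⟨w, hw, hwτ⟩ := intermediate_value_Icc huv hc (show τ ∈ Icc _ _ from
    ⟨by simpa using hτ.le, hcon⟩)
  have h1 := hγ _ (φ (α u + (w - u)) x) hwτ
  rw [← hφ.map_add, show α w - w - (α u - u) + (α u + (w - u)) = α w by ring] at h1
  have h2 := hxy w ⟨hu.trans hw.1, hw.2.trans hvt⟩
  have h3 := hεT _ _ (hxy u ⟨hu, huv.trans hvt⟩) (w - u)
    ⟨by linarith [hw.1], by linarith [hw.2]⟩
  rw [← hφ.map_add, ← hφ.map_add, sub_add_cancel, add_comm (w - u)] at h3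
  linarith [dist_triangle_right (φ (α w) x) (φ (α u + (w - u)) x) (φ w y)]

/-- The accumulated drift encoded by a sequence of increments in `{-1, 0, 1}`. -/
def drift (e : ℕ → Fin 3) (j : ℕ) : ℝ := ∑ i ∈ Finset.range j, (((e i : ℕ) : ℝ) - 1)

lemma exists_fin_three_eq {a b τ : ℝ} (hτ : 0 < τ) (h : |b - a| < τ) :
    ∃ c : Fin 3, ((c : ℕ) : ℝ) - 1 = ⌊b / τ⌋ - ⌊a / τ⌋ := by
  have h1 := Int.floor_le (a / τ)
  have h2 := Int.lt_floor_add_one (a / τ)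
  have h3 := Int.floor_le (b / τ)
  have h4 := Int.lt_floor_add_one (b / τ)
  have h5 : b / τ - a / τ < 1 := by
    rw [← sub_div, div_lt_one hτ]; exact (abs_lt.1 h).2
  have h6 : -1 < b / τ - a / τ := by
    rw [← sub_div, lt_div_iff₀ hτ]; linarith [(abs_lt.1 h).1]
  have h7 : ⌊b / τ⌋ - ⌊a / τ⌋ < 2 := by
    have : ((⌊b / τ⌋ - ⌊a / τ⌋ : ℤ) : ℝ) < (2 : ℤ) := by push_cast; linarith
    exact_mod_cast this
  have h8 : -2 < ⌊b / τ⌋ - ⌊a / τ⌋ := by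
    have : ((-2 : ℤ) : ℝ) < (⌊b / τ⌋ - ⌊a / τ⌋ : ℤ) := by push_cast; linarith
    exact_mod_cast this
  refine ⟨⟨(⌊b / τ⌋ - ⌊a / τ⌋ + 1).toNat, by omega⟩, ?_⟩
  have h9 : (((⌊b / τ⌋ - ⌊a / τ⌋ + 1).toNat : ℤ)) = ⌊b / τ⌋ - ⌊a / τ⌋ + 1 :=
    Int.toNat_of_nonneg (by omega)
  have h10 := congrArg (fun z : ℤ => (z : ℝ)) h9
  simp only [Int.cast_natCast] at h10
  rw [h10]
  push_cast
  ring

/-- An orbit in a reparametrization ball follows the central orbit up to a slowly varying drift. -/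
lemma exists_dist_drift_lt (hφ : IsFlow φ) {T τ γ ε ρ : ℝ} (hT : 0 ≤ T)
    (hγ : ∀ s z, |s| = τ → γ ≤ dist (φ s z) z) (hτ : 0 < τ)
    (hτρ : ∀ s, |s| ≤ τ → ∀ x, dist (φ s x) x < ρ / 2) (hε : ε ≤ γ / 2) (hερ : ε ≤ ρ / 2)
    (hεT : ∀ x y, dist x y < ε → ∀ s ∈ Icc 0 T, dist (φ s x) (φ s y) < γ / 2) {x y : X} {t : ℝ}
    (hy : y ∈ reparBall φ x t ε) :
    ∃ e : ℕ → Fin 3, ∀ j : ℕ, j * T ≤ t →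
      dist (φ (j * T) y) (φ (j * T + τ * drift e j) x) < ρ := by
  obtain ⟨α, ⟨hα, -, hα0⟩, hxy⟩ := hy
  have hstep : ∀ j : ℕ, ∃ c : Fin 3, (j + 1 : ℕ) * T ≤ t → ((c : ℕ) : ℝ) - 1 =
      ⌊(α ((j + 1 : ℕ) * T) - (j + 1 : ℕ) * T) / τ⌋ - ⌊(α (j * T) - j * T) / τ⌋ := by
    intro j
    by_cases hj : (j + 1 : ℕ) * T ≤ t
    · obtain ⟨c, hc⟩ := exists_fin_three_eq hτ (abs_drift_lt hφ hγ hτ hε hεT hα hxy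
        (u := j * T) (v := (j + 1 : ℕ) * T) (by positivity) (by push_cast; linarith) hj
        (by push_cast; linarith))
      exact ⟨c, fun _ => hc⟩
    · exact ⟨0, fun h => absurd h hj⟩
  choose e he using hstep
  refine ⟨e, fun j hj => ?_⟩
  have hdrift : ∀ i ≤ j, drift e i = ⌊(α (i * T) - i * T) / τ⌋ := by
    intro i hi
    induction i with
    | zero => simp [drift, hα0]
    | succ i ih =>
      have h1 : ((i + 1 : ℕ) : ℝ) * T ≤ t :=
        (mul_le_mul_of_nonneg_right (by exact_mod_cast hi) hT).trans hj
      have h2 := he i h1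
      have h3 := ih (by omega)
      rw [drift, Finset.sum_range_succ, ← drift, h3, h2]
      ring
  rw [hdrift j le_rfl]
  have h1 := hxy (j * T) ⟨by positivity, hj⟩
  set a := α (j * T) - j * T with ha
  have h3 := Int.floor_le (a / τ)
  have h4 := Int.lt_floor_add_one (a / τ)
  rw [le_div_iff₀ hτ] at h3
  rw [div_lt_iff₀ hτ] at h4
  have h5 := hτρ (a - τ * ⌊a / τ⌋) (abs_le.2 ⟨by linarith, by linarith⟩)
    (φ (j * T + τ * ⌊a / τ⌋) x)
  rw [← hφ.map_add, show a - τ * ⌊a / τ⌋ + (j * T + τ * ⌊a / τ⌋) = α (j * T) by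
    rw [ha]; ring] at h5
  rw [dist_comm] at h1
  linarith [dist_triangle (φ (j * T) y) (φ (α (j * T)) x) (φ (j * T + τ * ⌊a / τ⌋) x)]

end Drift

section Cover

variable [MetricSpace X] [CompactSpace X] {φ : ℝ → X → X}

lemma isOpen_reparBall (hφ : IsFlow φ) (x : X) (t ε : ℝ) : IsOpen (reparBall φ x t ε) := by
  refine Metric.isOpen_iff.2 fun y hy => ?_
  obtain ⟨α, hα, hxy⟩ := hy
  rcases lt_or_ge t 0 with ht | ht
  · exact ⟨1, one_pos, fun z _ => ⟨α, hα, fun s hs => absurd (hs.1.trans hs.2) ht.not_ge⟩⟩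
  have hc : ContinuousOn (fun s => dist (φ (α s) x) (φ s y)) (Icc 0 t) :=
    continuous_dist.comp_continuousOn (((hφ.continuous_orbit x).comp_continuousOn hα.1).prodMk
      (hφ.continuous_orbit y).continuousOn)
  obtain ⟨s₀, hs₀, hmax⟩ := isCompact_Icc.exists_isMaxOn (nonempty_Icc.2 ht) hc
  obtain ⟨δ, hδ, h⟩ := hφ.exists_dist_flow_lt t (sub_pos.2 (hxy s₀ hs₀))
  refine ⟨δ, hδ, fun z hz => ⟨α, hα, fun s hs => ?_⟩⟩
  have h1 := h y z (by rwa [dist_comm]) s hs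
  have h2 : dist (φ (α s) x) (φ s y) ≤ dist (φ (α s₀) x) (φ s₀ y) := hmax hs
  linarith [dist_triangle (φ (α s) x) (φ s y) (φ s z)]

lemma exists_finset_of_coverM_eq_zero [MeasurableSpace X] [BorelSpace X] (hφ : IsFlow φ)
    {μ : Measure X} [IsProbabilityMeasure μ] {Z : Set X} (hZ : ∀ᵐ x ∂μ, x ∈ Z) {s ε : ℝ}
    (h : coverM φ Z s 0 ε = 0) {δ : ℝ≥0∞} (hδ : δ ≠ 0) :
    ∃ F : Finset (X × ℝ), (∀ p ∈ F, 0 ≤ p.2) ∧ ∑ p ∈ F, Real.exp (-s * p.2) ≤ 1 / 2 ∧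
      μ (⋃ p ∈ F, reparBall φ p.1 p.2 ε)ᶜ < δ := by
  have hlt : coverM φ Z s 0 ε < ENNReal.ofReal (1 / 2) := by
    rw [h]; exact ENNReal.ofReal_pos.2 (by norm_num)
  simp only [coverM, iInf_lt_iff] at hlt
  obtain ⟨F, hF, hF0, hZF, hsum⟩ := hlt
  have hopen : IsOpen (⋃ p ∈ F, reparBall φ p.1 p.2 ε) :=
    isOpen_biUnion fun p _ => isOpen_reparBall hφ _ _ _
  obtain ⟨K, hKU, hK, hμK⟩ := hopen.measurableSet.exists_isCompact_sdiff_lt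
    (measure_ne_top μ _) hδ
  obtain ⟨b, hbF, hb, hKb⟩ := hK.elim_finite_subcover_image
    (fun p _ => isOpen_reparBall hφ _ _ _) hKU
  lift b to Finset (X × ℝ) using hb
  refine ⟨b, fun p hp => by simpa using hF0 p (hbF hp), ?_, ?_⟩
  · have h1 := (ENNReal.tsum_mono_subtype
      (fun p : X × ℝ => ENNReal.ofReal (Real.exp (-s * p.2))) hbF).trans hsum.le
    have h2 := Finset.tsum_subtype b fun p : X × ℝ => ENNReal.ofReal (Real.exp (-s * p.2))
    change ∑' p : b, ENNReal.ofReal (Real.exp (-s * (p : X × ℝ).2)) ≤ _ at h1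
    rw [h2, ← ENNReal.ofReal_sum_of_nonneg fun p _ => (Real.exp_pos _).le] at h1
    exact (ENNReal.ofReal_le_ofReal_iff (by norm_num)).1 h1
  · refine (measure_mono_ae ?_).trans_lt hμK
    filter_upwards [hZ] with x hx hxb
    exact ⟨hZF hx, fun hxK => hxb (by simpa using hKb hxK)⟩

lemma exists_isClosed_separated [MeasurableSpace X] [BorelSpace X] (μ : Measure X)
    [IsProbabilityMeasure μ] {ι : Type*} [Finite ι] [MeasurableSpace ι]
    [MeasurableSingletonClass ι] {Q : X → ι} (hQ : Measurable Q) {δ : ℝ≥0∞} (hδ : δ ≠ 0) :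
    ∃ K : Set X, IsClosed K ∧ μ Kᶜ < δ ∧
      ∃ ρ > 0, ∀ x ∈ K, ∀ y ∈ K, dist x y < ρ → Q x = Q y := by
  cases nonempty_fintype ι
  obtain ⟨δ', hδ'0, hδ'⟩ := ENNReal.exists_pos_sum_of_countable hδ ι
  have hex : ∀ i, ∃ K ⊆ Q ⁻¹' {i}, IsCompact K ∧ μ (Q ⁻¹' {i} \ K) < δ' i := fun i =>
    (hQ (measurableSet_singleton i)).exists_isCompact_sdiff_lt (measure_ne_top μ _)
      (by exact_mod_cast (hδ'0 i).ne')
  choose K hKQ hK hμK using hex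
  have hKcl : ∀ i, IsClosed (K i) := fun i => (hK i).isClosed
  refine ⟨⋃ i, K i, isClosed_iUnion_of_finite hKcl, ?_, ?_⟩
  · have hsub : (⋃ i, K i)ᶜ ⊆ ⋃ i, Q ⁻¹' {i} \ K i := fun x hx =>
      mem_iUnion.2 ⟨Q x, rfl, fun hxK => hx (mem_iUnion.2 ⟨_, hxK⟩)⟩
    refine ((measure_mono hsub).trans (measure_iUnion_le _)).trans_lt (lt_of_le_of_lt ?_ hδ')
    exact ENNReal.tsum_le_tsum fun i => (hμK i).le
  · obtain ⟨ρ, hρ, h⟩ := lebesgue_number_lemma_of_metric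
      (isCompact_iUnion hK) (c := fun i => (⋃ j ∈ {j | j ≠ i}, K j)ᶜ)
      (fun i => ((toFinite _).isClosed_biUnion fun j _ => hKcl j).isOpen_compl) (by
        intro x hx
        obtain ⟨i, hi⟩ := mem_iUnion.1 hx
        refine mem_iUnion.2 ⟨i, fun hx' => ?_⟩
        obtain ⟨j, hj, hxj⟩ := mem_iUnion₂.1 hx'
        exact hj ((hKQ j hxj).symm.trans (hKQ i hi)))
    have key : ∀ i, ∀ x ∈ ⋃ i, K i, x ∈ (⋃ j ∈ {j | j ≠ i}, K j)ᶜ → Q x = i := by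
      intro i x hx hxi
      obtain ⟨j, hj⟩ := mem_iUnion.1 hx
      by_contra hne
      exact hxi (mem_iUnion₂.2 ⟨j, fun hji => hne ((hKQ j hj).trans hji), hj⟩)
    refine ⟨ρ, hρ, fun x hx y hy hxy => ?_⟩
    obtain ⟨i, hi⟩ := h x hx
    rw [key i x hx (hi (Metric.mem_ball_self hρ)), key i y hy (hi (by rwa [Metric.mem_ball']))]

end Cover

section Tracking

variable {ι : Type*} [Fintype ι]

open Classical in
/-- The letter distribution giving mass one half to a predicted letter and spreading the rest
evenly. -/
noncomputable def predDist (a i : ι) : ℝ :=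
  (if i = a then 1 / 2 else 0) + 1 / (2 * Fintype.card ι)

lemma isSubProb_predDist (a : ι) : IsSubProb (predDist a) := by
  classical
  have : Nonempty ι := ⟨a⟩
  have hpos : (0 : ℝ) < Fintype.card ι := by exact_mod_cast Fintype.card_pos
  refine ⟨fun i => ?_, le_of_eq ?_⟩
  · unfold predDist
    split <;> positivity
  · have h1 : ∑ i, (if i = a then (1 / 2 : ℝ) else 0) = 1 / 2 := by
      simp
    simp only [predDist, Finset.sum_add_distrib, Finset.sum_const, Finset.card_univ,
      nsmul_eq_mul]
    rw [h1]
    field_simp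
    norm_num

lemma exp_neg_log_two_le_predDist (a : ι) : Real.exp (-Real.log 2) ≤ predDist a a := by
  rw [Real.exp_neg, Real.exp_log two_pos, predDist, if_pos rfl]
  have : (0 : ℝ) ≤ 1 / (2 * Fintype.card ι) := by positivity
  linarith

lemma exp_neg_log_card_le_predDist (a i : ι) :
    Real.exp (-(Real.log 2 + Real.log (Fintype.card ι))) ≤ predDist a i := by
  have : Nonempty ι := ⟨a⟩
  have hpos : (0 : ℝ) < Fintype.card ι := by exact_mod_cast Fintype.card_pos
  rw [← Real.log_mul two_ne_zero hpos.ne', Real.exp_neg, Real.exp_log (by positivity), predDist,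
    one_div (2 * _)]
  classical
  have h1 : (0 : ℝ) ≤ if i = a then 1 / 2 else 0 := by split <;> norm_num
  linarith

lemma exp_birkhoffSum_le_listProb {ι : Type*} {T : X → X} {Q : X → ι} {F : X → ℝ}
    (l : List (ι → ℝ)) (y : X)
    (h : ∀ (j : ℕ) (hj : j < l.length), Real.exp (-F (T^[j] y)) ≤ l[j] (Q (T^[j] y))) :
    Real.exp (-birkhoffSum T F l.length y) ≤ listProb T Q l y := by
  induction l generalizing y with
  | nil => simp [listProb]
  | cons p l ih =>
    rw [List.length_cons, birkhoffSum_succ', neg_add, Real.exp_add, listProb]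
    have h0 := h 0 (by simp)
    refine mul_le_mul h0 (ih (T y) fun j hj => ?_) (Real.exp_pos _).le
      ((Real.exp_pos _).le.trans h0)
    exact h (j + 1) (by simpa using hj)

/-- If, outside a small exceptional set, long stretches of the itinerary are predicted up to
another small set by one of few predictions with few corrections, then the entropy is small. -/
lemma partEnt_le_of_prediction [Nonempty ι] [MeasurableSpace X] {μ : Measure X}
    [IsProbabilityMeasure μ] {T : X → X} (hT : MeasurePreserving T μ μ) {Q : X → ι}
    {β : Type*} (S : Finset β) {W : β → ℝ} (hW : ∑ p ∈ S, W p ≤ 1 / 2) {m : β → ℕ}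
    (hm : ∀ p, 0 < m p) {c : ℝ} (hc : 0 ≤ c) (hWc : ∀ p ∈ S, Real.exp (-(m p * c)) ≤ W p)
    (pred : (p : β) → (Fin (m p) → Fin 3) → ℕ → ι) {A B : Set X} (hA : MeasurableSet A)
    (hB : MeasurableSet B) (hpred : ∀ y ∉ B, ∃ p ∈ S, ∃ e, ∀ j < m p, T^[j] y ∉ A →
      pred p e j = Q (T^[j] y)) :
    ∃ L : ℕ, ∀ (n : ℕ) (κ : Type) [Fintype κ] (R : X → κ), (∀ i, MeasurableSet (R ⁻¹' {i})) →
      ∀ π : (Fin n → ι) → κ, (∀ y, R y = π (itin T Q n y)) →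
      partEnt μ R ≤ (n + L : ℕ) *
        (c + Real.log 6 + Real.log (Fintype.card ι) * (μ.real A + μ.real B)) := by
  classical
  obtain ⟨i₀⟩ := ‹Nonempty ι›
  have hpos : (1 : ℝ) ≤ Fintype.card ι := by exact_mod_cast Fintype.card_pos_iff.2 ⟨i₀⟩
  have hlog : 0 ≤ Real.log (Fintype.card ι) := Real.log_nonneg hpos
  have hlog6 : Real.log 6 = Real.log 3 + Real.log 2 := by
    rw [← Real.log_mul (by norm_num) (by norm_num)]; norm_num
  have hlog3 : 0 ≤ Real.log 3 := Real.log_nonneg (by norm_num)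
  have hlog2 : 0 ≤ Real.log 2 := Real.log_nonneg (by norm_num)
  have hlog23 : Real.log 2 ≤ Real.log 3 := Real.log_le_log (by norm_num) (by norm_num)
  let w : Option (Σ p : S, (Fin (m p) → Fin 3)) → ℝ := fun o =>
    o.elim (1 / 2) fun c => W c.1 * ((3 : ℝ) ^ m c.1)⁻¹
  let word : Option (Σ p : S, (Fin (m p) → Fin 3)) → List (ι → ℝ) := fun o =>
    o.elim [predDist i₀] fun c => List.ofFn fun j : Fin (m c.1) => predDist (pred c.1 c.2 j)
  have hw : IsSubProb w := by
    refine ⟨fun o => ?_, ?_⟩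
    · rcases o with _ | ⟨p, e⟩
      · simp [w]
      · exact mul_nonneg ((Real.exp_pos _).le.trans (hWc p p.2)) (by positivity)
    · rw [Fintype.sum_option, Fintype.sum_sigma]
      have h1 : ∀ p : S, ∑ e : Fin (m p) → Fin 3, w (some ⟨p, e⟩) = W p := fun p => by
        simp [w]
        field_simp
      rw [Finset.sum_congr rfl fun p _ => h1 p, Finset.sum_coe_sort S W]
      simp only [w, Option.elim_none]
      linarith
  have hword : ∀ o, ∀ p ∈ word o, IsSubProb p := by
    rintro (_ | ⟨p, e⟩) d hd
    · obtain rfl : d = predDist i₀ := by simpa [word] using hd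
      exact isSubProb_predDist _
    · obtain ⟨j, rfl⟩ : ∃ j : Fin (m p), predDist (pred p e j) = d := by
        simpa [word, List.mem_ofFn] using hd
      exact isSubProb_predDist _
  have hlen : ∀ p e, (word (some ⟨p, e⟩)).length = m p := fun p e => by simp [word]
  have hne : ∀ o, word o ≠ [] := by
    rintro (_ | ⟨p, e⟩)
    · simp [word]
    · rw [← List.length_pos_iff, hlen]
      exact hm p
  have hL : ∀ o, (word o).length ≤ S.sup m + 1 := by
    rintro (_ | ⟨p, e⟩)
    · simp [word]
    · rw [hlen]
      exact (Finset.le_sup p.2).trans (Nat.le_succ _)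
  let G : X → ℝ := fun x =>
    c + Real.log 6 + Real.log (Fintype.card ι) * (A.indicator 1 x + B.indicator 1 x)
  have hind : ∀ (D : Set X) x, 0 ≤ D.indicator (1 : X → ℝ) x := fun D x =>
    indicator_nonneg (fun _ _ => zero_le_one) x
  have hiA : Integrable (A.indicator (1 : X → ℝ)) μ :=
    (integrable_indicator_iff hA).2 (integrable_const (1 : ℝ)).integrableOn
  have hiB : Integrable (B.indicator (1 : X → ℝ)) μ :=
    (integrable_indicator_iff hB).2 (integrable_const (1 : ℝ)).integrableOn
  have hGi : Integrable G μ := (integrable_const _).add ((hiA.add hiB).const_mul _)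
  have hG : ∫ x, G x ∂μ =
      c + Real.log 6 + Real.log (Fintype.card ι) * (μ.real A + μ.real B) := by
    simp only [G]
    rw [integral_add (f := fun _ => c + Real.log 6)
      (g := fun x => Real.log (Fintype.card ι) * (A.indicator 1 x + B.indicator 1 x))
      (integrable_const _) ((hiA.add hiB).const_mul _), integral_const,
      integral_const_mul, integral_add hiA hiB, integral_indicator_one hA,
      integral_indicator_one hB]
    simp
  refine ⟨S.sup m + 1, fun n κ _ R hR π hπ => ?_⟩
  rw [← hG]
  refine partEnt_le_of_code hw hword hne hL hT (F := G) (fun x => ?_) hGi (fun y => ?_) n hR π hπ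
  · have := mul_nonneg hlog (add_nonneg (hind A x) (hind B x))
    simp only [G]
    linarith
  by_cases hy : y ∈ B
  · refine ⟨none, ?_⟩
    simp only [word, w, Option.elim_none, List.length_singleton, birkhoffSum_one, listProb,
      mul_one]
    refine le_trans ?_ (mul_le_mul_of_nonneg_left (exp_neg_log_card_le_predDist i₀ (Q y))
      one_half_pos.le)
    rw [show (1 / 2 : ℝ) = Real.exp (-Real.log 2) by
      rw [Real.exp_neg, Real.exp_log two_pos, one_div], ← Real.exp_add]
    refine Real.exp_le_exp.2 ?_
    have h1 := mul_nonneg hlog (hind A y)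
    simp only [G, indicator_of_mem hy, Pi.one_apply, mul_add]
    linarith
  · obtain ⟨p, hp, e, he⟩ := hpred y hy
    refine ⟨some ⟨⟨p, hp⟩, e⟩, ?_⟩
    have h1 := exp_birkhoffSum_le_listProb (T := T) (Q := Q)
      (F := fun x => Real.log 2 + Real.log (Fintype.card ι) * A.indicator 1 x)
      (word (some ⟨⟨p, hp⟩, e⟩)) y fun j hj => by
        rw [hlen] at hj
        have h2 : (word (some ⟨⟨p, hp⟩, e⟩))[j]'(by rwa [hlen]) = predDist (pred p e j) := by
          simp [word]
        rw [h2]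
        by_cases hjA : T^[j] y ∈ A
        · simpa [hjA] using exp_neg_log_card_le_predDist (pred p e j) (Q (T^[j] y))
        · simpa [hjA, he j hj hjA] using exp_neg_log_two_le_predDist (Q (T^[j] y))
    refine le_trans ?_ (mul_le_mul_of_nonneg_left h1 (hw.1 _))
    rw [hlen]
    have h2 : Real.exp (-(m p * (c + Real.log 3))) ≤ w (some ⟨⟨p, hp⟩, e⟩) := by
      have h3 : Real.exp (-(m p * (c + Real.log 3))) =
          Real.exp (-(m p * c)) * ((3 : ℝ) ^ m p)⁻¹ := by
        rw [mul_add, neg_add, Real.exp_add, Real.exp_neg (m p * Real.log 3), Real.exp_nat_mul,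
          Real.exp_log three_pos]
      rw [h3]
      exact mul_le_mul_of_nonneg_right (hWc p hp) (by positivity)
    refine le_trans ?_ (mul_le_mul_of_nonneg_right h2 (Real.exp_pos _).le)
    rw [← Real.exp_add, ← neg_add]
    refine Real.exp_le_exp.2 (neg_le_neg ?_)
    have h4 : (m p * (c + Real.log 3) : ℝ) = ∑ _j ∈ Finset.range (m p), (c + Real.log 3) := by
      rw [Finset.sum_const, Finset.card_range, nsmul_eq_mul]
    rw [h4, birkhoffSum, birkhoffSum, ← Finset.sum_add_distrib]
    refine Finset.sum_le_sum fun j _ => ?_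
    have h5 := mul_nonneg hlog (hind B (T^[j] y))
    simp only [G, mul_add]
    linarith

end Tracking

section LowerBound

variable [MetricSpace X] [CompactSpace X] [MeasurableSpace X] [BorelSpace X] {φ : ℝ → X → X}

lemma exists_partEnt_le (hφ : IsFlow φ) (hfp : FixedPointFree φ) {μ : Measure X}
    [IsProbabilityMeasure μ] (hinv : FlowInvariant φ μ) {Z : Set X} (hZ : ∀ᵐ x ∂μ, x ∈ Z) {s : ℝ}
    (hs : 0 ≤ s) (h : coverMlim φ Z s = 0) {k : ℕ} {P : X → Fin k} (hP : Measurable P) {T : ℕ}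
    (hT : 0 < T) : ∃ L : ℕ, ∀ n : ℕ,
      partEnt μ (fun x => fun j : Fin n => P ((φ 1)^[(j : ℕ)] x)) ≤
        (n / T + 1 + L : ℕ) * (s * T + Real.log 6 + 1) := by
  have hX : Nonempty X := by
    by_contra hX
    rw [not_nonempty_iff] at hX
    exact IsProbabilityMeasure.ne_zero μ (Subsingleton.elim _ _)
  have hT0 : (0 : ℝ) < T := by exact_mod_cast hT
  let Q : X → Fin T → Fin k := fun x j => P ((φ 1)^[(j : ℕ)] x)
  have hQ : Measurable Q := measurable_pi_lambda _ fun j => hP.comp ((hinv 1).measurable.iterate j)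
  have : Nonempty (Fin T → Fin k) := hX.map Q
  set c := Real.log (Fintype.card (Fin T → Fin k)) with hc
  have hc0 : 0 ≤ c := Real.log_nonneg (by exact_mod_cast Fintype.card_pos)
  set δ : ℝ := 1 / (2 * (c + 1)) with hδ
  have hδ0 : 0 < δ := by positivity
  have hδ' : ENNReal.ofReal δ ≠ 0 := (ENNReal.ofReal_pos.2 hδ0).ne'
  have hreal : ∀ D : Set X, μ D < ENNReal.ofReal δ → μ.real D ≤ δ := fun D hD =>
    ENNReal.toReal_le_of_le_ofReal hδ0.le hD.le
  obtain ⟨K, hK, hμK, ρ, hρ, hKρ⟩ := exists_isClosed_separated μ hQ hδ'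
  obtain ⟨r, hr0, hr⟩ := hφ.exists_dist_lt (half_pos (half_pos hρ))
  obtain ⟨τ, hτ, hτr, γ, hγ, hτγ⟩ := hφ.exists_le_dist_map hfp hr0
  obtain ⟨ε₁, hε₁, hεT⟩ := hφ.exists_dist_flow_lt T (half_pos hγ)
  set ε := min ε₁ (min (γ / 2) (ρ / 2 / 2)) with hεdef
  have hε : 0 < ε := by positivity
  have hcov : coverM φ Z s 0 ε = 0 := by
    simp only [coverMlim, coverMeps, ENNReal.iSup_eq_zero] at h
    exact h ε hε 0
  obtain ⟨S, hS0, hS, hμS⟩ := exists_finset_of_coverM_eq_zero hφ hZ hcov hδ'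
  let m : X × ℝ → ℕ := fun p => ⌊p.2 / T⌋₊ + 1
  let extend : (p : X × ℝ) → (Fin (m p) → Fin 3) → ℕ → Fin 3 := fun p e i =>
    if hi : i < m p then e ⟨i, hi⟩ else 0
  let pred : (p : X × ℝ) → (Fin (m p) → Fin 3) → ℕ → Fin T → Fin k := fun p e j =>
    Q (Classical.epsilon fun z => z ∈ K ∧ dist z (φ (j * T + τ * drift (extend p e) j) p.1) < ρ / 2)
  have hopen : IsOpen (⋃ p ∈ S, reparBall φ p.1 p.2 ε) :=
    isOpen_biUnion fun p _ => isOpen_reparBall hφ _ _ _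
  have hiter : ∀ (j : ℕ) x, (φ 1)^[j] x = φ j x := fun j x => by rw [hφ.iterate, mul_one]
  have hW : ∀ p ∈ S, Real.exp (-(m p * (s * T))) ≤ Real.exp (-s * p.2) := by
    intro p hp
    refine Real.exp_le_exp.2 ?_
    have h1 := Nat.lt_floor_add_one (p.2 / T)
    rw [div_lt_iff₀ hT0] at h1
    have h2 : s * p.2 ≤ s * ((⌊p.2 / T⌋₊ + 1) * T) := mul_le_mul_of_nonneg_left h1.le hs
    simp only [m]
    push_cast
    linarith
  have hpred : ∀ y ∉ (⋃ p ∈ S, reparBall φ p.1 p.2 ε)ᶜ, ∃ p ∈ S, ∃ e, ∀ j < m p,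
      (φ T)^[j] y ∉ Kᶜ → pred p e j = Q ((φ T)^[j] y) := by
    intro y hy
    rw [mem_compl_iff, not_not] at hy
    obtain ⟨p, hp, hyp⟩ := mem_iUnion₂.1 hy
    obtain ⟨e, he⟩ := exists_dist_drift_lt hφ hT0.le hτγ hτ (fun u hu => hr u (hu.trans hτr))
      ((min_le_right _ _).trans (min_le_left _ _)) ((min_le_right _ _).trans (min_le_right _ _))
      (fun x z hxz => hεT x z (hxz.trans_le (min_le_left _ _))) hyp
    refine ⟨p, hp, fun i => e i, fun j hj hjK => ?_⟩
    rw [mem_compl_iff, not_not, hφ.iterate] at hjK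
    have hjt : j * (T : ℝ) ≤ p.2 := by
      rw [← le_div_iff₀ hT0]
      exact (Nat.le_floor_iff (div_nonneg (hS0 p hp) hT0.le)).1 (Nat.lt_succ_iff.1 hj)
    have hdrift : drift (extend p fun i => e i) j = drift e j :=
      Finset.sum_congr rfl fun i hi => by
        simp only [extend, dif_pos ((Finset.mem_range.1 hi).trans hj)]
    have h1 := he j hjt
    rw [← hdrift] at h1
    have h2 := Classical.epsilon_spec (p := fun z => z ∈ K ∧
      dist z (φ (j * T + τ * drift (extend p fun i => e i) j) p.1) < ρ / 2) ⟨_, hjK, h1⟩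
    rw [hφ.iterate]
    refine hKρ _ h2.1 _ hjK ?_
    linarith [dist_triangle_right (Classical.epsilon fun z => z ∈ K ∧
      dist z (φ (j * T + τ * drift (extend p fun i => e i) j) p.1) < ρ / 2) (φ (j * T) y)
        (φ (j * T + τ * drift (extend p fun i => e i) j) p.1), h2.2]
  obtain ⟨L, hL⟩ := partEnt_le_of_prediction (hinv T) S hS (m := m) (fun p => Nat.succ_pos _)
    (mul_nonneg hs hT0.le) hW pred hK.measurableSet.compl hopen.measurableSet.compl hpred
  refine ⟨L, fun n => ?_⟩
  refine (hL (n / T + 1) (Fin n → Fin k) _ (fun i => ?_)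
    (fun ω j => ω ⟨j / T, Nat.lt_succ_of_le (Nat.div_le_div_right j.2.le)⟩
      ⟨j % T, Nat.mod_lt _ hT⟩) fun y => ?_).trans ?_
  · exact measurable_pi_lambda _ (fun j : Fin n => hP.comp ((hinv 1).measurable.iterate j))
      (measurableSet_singleton i)
  · funext j
    change P ((φ 1)^[(j : ℕ)] y) = P ((φ 1)^[(j : ℕ) % T] ((φ T)^[(j : ℕ) / T] y))
    rw [hiter, hiter, hφ.iterate, ← hφ.map_add]
    congr 2
    exact_mod_cast (Nat.mod_add_div' (j : ℕ) T).symm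
  · refine mul_le_mul_of_nonneg_left ?_ (Nat.cast_nonneg _)
    have h1 := add_le_add (hreal _ hμK) (hreal _ hμS)
    have h2 := mul_le_mul_of_nonneg_left h1 hc0
    have h3 : c * (δ + δ) ≤ 1 := by
      have h4 : c * (δ + δ) = c / (c + 1) := by
        rw [hδ]
        field_simp
        norm_num
      rw [h4]
      exact div_le_one_of_le₀ (by linarith) (by linarith)
    linarith

lemma limsup_le_of_forall_le {u : ℕ → ℝ} {s a : ℝ} (ha : 0 ≤ a) (hs : 0 ≤ s)
    (h : ∀ T : ℕ, 0 < T → ∃ L : ℕ, ∀ n : ℕ, u n ≤ (n / T + 1 + L : ℕ) * (s * T + a)) :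
    limsup (fun n : ℕ => ENNReal.ofReal (u n / n)) atTop ≤ ENNReal.ofReal s := by
  have hT : ∀ T : ℕ, 0 < T →
      limsup (fun n : ℕ => ENNReal.ofReal (u n / n)) atTop ≤ ENNReal.ofReal (s + a / T) := by
    intro T hT
    have hT0 : (0 : ℝ) < T := by exact_mod_cast hT
    obtain ⟨L, hL⟩ := h T hT
    have hlim : Tendsto (fun n : ℕ => ENNReal.ofReal ((s + a / T) + (1 + L) * (s * T + a) / n))
        atTop (𝓝 (ENNReal.ofReal (s + a / T + 0))) :=
      ENNReal.tendsto_ofReal (tendsto_const_nhds.add (tendsto_const_div_atTop_nhds_zero_nat _))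
    rw [add_zero] at hlim
    rw [← hlim.limsup_eq]
    refine limsup_le_limsup ?_
    filter_upwards [eventually_gt_atTop 0] with n hn
    have hn0 : (0 : ℝ) < n := by exact_mod_cast hn
    refine ENNReal.ofReal_le_ofReal ?_
    rw [div_le_iff₀ hn0]
    refine (hL n).trans ?_
    have h1 : ((n / T : ℕ) : ℝ) ≤ n / T := Nat.cast_div_le
    have h2 : ((n / T + 1 + L : ℕ) : ℝ) * (s * T + a) ≤ (n / T + 1 + L) * (s * T + a) := by
      push_cast
      gcongr
    refine h2.trans (le_of_eq ?_)
    field_simp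
    ring
  have hlim : Tendsto (fun T : ℕ => ENNReal.ofReal (s + a / T)) atTop
      (𝓝 (ENNReal.ofReal (s + 0))) :=
    ENNReal.tendsto_ofReal (tendsto_const_nhds.add (tendsto_const_div_atTop_nhds_zero_nat _))
  rw [add_zero] at hlim
  refine ge_of_tendsto hlim ?_
  filter_upwards [eventually_gt_atTop 0] with T h using hT T h

lemma kolSinai_le_bowenEntropy (hφ : IsFlow φ) (hfp : FixedPointFree φ) {μ : Measure X}
    [IsProbabilityMeasure μ] (hinv : FlowInvariant φ μ) {Z : Set X} (hZ : ∀ᵐ x ∂μ, x ∈ Z) :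
    kolSinai μ (φ 1) ≤ bowenEntropy φ Z := by
  refine le_iInf₂ fun s hs => le_iInf fun h => iSup₂_le fun k P => iSup_le fun hP => ?_
  have hlog : 0 ≤ Real.log 6 := Real.log_nonneg (by norm_num)
  refine limsup_le_of_forall_le (a := Real.log 6 + 1) (by linarith) hs fun T hT => ?_
  simpa only [add_assoc] using exists_partEnt_le hφ hfp hinv hZ hs h hP hT

end LowerBound

/-- **Theorem (main).** For a compact metric flow `φ` without fixed points and an ergodic
`φ`-invariant Borel probability measure `μ`, the Bowen entropy of the set of generic
points of `μ` equals the measure-theoretic entropy of the time-one map. -/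
theorem bowenEntropy_genericPts {X : Type*} [MetricSpace X] [CompactSpace X]
    [MeasurableSpace X] [BorelSpace X] (φ : ℝ → X → X) (hφ : IsFlow φ)
    (hfp : FixedPointFree φ) (μ : Measure X) [IsProbabilityMeasure μ]
    (herg : FlowErgodic φ μ) :
    bowenEntropy φ (genericPts φ μ) = kolSinai μ (φ 1) := by
  exact le_antisymm (bowenEntropy_genericPts_le hφ herg.1)
    (kolSinai_le_bowenEntropy hφ hfp herg.1 (ae_mem_genericPts hφ herg))

end FlowEntropy
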